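/- arXiv:2602.21938 — 13 statements merged into one kernel-verified Lean document; each statement's English description precedes it below -/
import Mathlib

section
/- Let p : (0,1) → (0,∞) be an admissible exponent family. For every η > 0 there exists ε₀ ∈ (0,1) such that for all ε ∈ (0,ε₀) and all z ∈ ℝ one has (1/(ε·|log ε|))·log(1 + ε·|log ε|·z²) ≥ (1−η)·min{ε^{1−2p(ε)}·z², 1/ε}. -/
open Real Filter Topology Set

/-- An admissible exponent family: `p : (0,1) → (0,∞)` with `p ε → 0` and
`log |log ε| / (p ε · |log ε|) → 0` as `ε → 0⁺`, where `|log ε| = -log ε`. -/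
def IsAdmissibleExponent (p : ℝ → ℝ) : Prop :=
  (∀ ε ∈ Set.Ioo (0:ℝ) 1, 0 < p ε) ∧
  Tendsto p (𝓝[>] (0:ℝ)) (𝓝 0) ∧
  Tendsto (fun ε : ℝ => Real.log (-Real.log ε) / (p ε * (-Real.log ε))) (𝓝[>] (0:ℝ)) (𝓝 0)

/-- Concavity of `log (1 + ·)` along the segment from `0` to `x`. -/
lemma mul_log_one_add_le_log_one_add_mul {t x : ℝ} (ht : 0 ≤ t) (ht1 : t ≤ 1) (hx : 0 ≤ x) :
    t * Real.log (1 + x) ≤ Real.log (1 + t * x) := by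
  rw [← Real.log_rpow (by linarith)]
  exact Real.log_le_log (by positivity)
    (rpow_one_add_le_one_add_mul_self (by linarith) ht ht1)

theorem stmt_1 (p : ℝ → ℝ) (hp : IsAdmissibleExponent p) :
    ∀ η : ℝ, 0 < η → ∃ ε₀ ∈ Set.Ioo (0:ℝ) 1, ∀ ε ∈ Set.Ioo (0:ℝ) ε₀, ∀ z : ℝ,
      (1 - η) * min (ε ^ (1 - 2 * p ε) * z ^ 2) (1 / ε) ≤
        (1 / (ε * (-Real.log ε))) * Real.log (1 + ε * (-Real.log ε) * z ^ 2) := by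
  intro η hη
  have hev : ∀ᶠ ε in 𝓝[>] (0:ℝ), p ε < η / 2 :=
    hp.2.1.eventually (gt_mem_nhds (by positivity))
  obtain ⟨δ, hδ, hδp⟩ := mem_nhdsGT_iff_exists_Ioo_subset.1 hev
  have hexp : Real.exp (-1) < 1 := by simp
  refine ⟨min δ (Real.exp (-1)), ⟨lt_min hδ (Real.exp_pos _),
    (min_le_right _ _).trans_lt hexp⟩, ?_⟩
  rintro ε ⟨hε, hε'⟩ z
  have hpε : p ε < η / 2 := hδp ⟨hε, hε'.trans_le (min_le_left _ _)⟩
  have hL : 1 < -Real.log ε := by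
    have h := Real.log_lt_log hε (hε'.trans_le (min_le_right _ _))
    rw [Real.log_exp] at h
    linarith
  set L := -Real.log ε with hLdef
  set q := ε ^ (1 - 2 * p ε) with hq
  have hq0 : 0 < q := Real.rpow_pos_of_pos hε _
  have hlogq : Real.log q = -(1 - 2 * p ε) * L := by
    rw [hq, Real.log_rpow hε, hLdef]; ring
  have hL0 : 0 < L := by linarith
  have hthreshold : (1 - η) * L ≤ Real.log (1 + L / q) := by
    calc (1 - η) * L ≤ (1 - 2 * p ε) * L := by gcongr; linarith
      _ ≤ Real.log L - Real.log q := by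
        rw [hlogq]; linarith [Real.log_nonneg hL.le]
      _ = Real.log (L / q) := (Real.log_div hL0.ne' hq0.ne').symm
      _ ≤ Real.log (1 + L / q) := Real.log_le_log (by positivity) (by linarith)
  rw [div_mul_eq_mul_div, one_mul, le_div_iff₀ (by positivity)]
  rcases le_total (q * z ^ 2) (1 / ε) with h | h
  · rw [min_eq_left h]
    have ht1 : ε * q * z ^ 2 ≤ 1 := by
      rw [le_div_iff₀ hε] at h; linarith
    calc (1 - η) * (q * z ^ 2) * (ε * L) = ε * q * z ^ 2 * ((1 - η) * L) := by ring
      _ ≤ ε * q * z ^ 2 * Real.log (1 + L / q) := by gcongr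
      _ ≤ Real.log (1 + ε * q * z ^ 2 * (L / q)) :=
        mul_log_one_add_le_log_one_add_mul (by positivity) ht1 (by positivity)
      _ = Real.log (1 + ε * L * z ^ 2) := by
        congr 2; field_simp
  · rw [min_eq_right h]
    calc (1 - η) * (1 / ε) * (ε * L) = (1 - η) * L := by field_simp
      _ ≤ Real.log (1 + L / q) := hthreshold
      _ ≤ Real.log (1 + ε * L * z ^ 2) := by
        refine Real.log_le_log (by positivity) ?_
        rw [div_le_iff₀ hε] at h
        rw [add_le_add_iff_left, div_le_iff₀ hq0]
        nlinarith
end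

section
/- Let k ≥ 3 be an integer. There exists a constant R_k > 0, depending only on k, such that for every ℓ ∈ {2,…,k−1}, every p > 0, every ε ∈ (0,1), every bounded open interval I of positive length, and every function u : ℝ → ℝ of class C^k, one has ∫_I |u^{(ℓ)}(t)|² dt ≤ R_k · ε^{1−2ℓ−2p(k−ℓ)/(k−1)} · ( ε^{1−2p} ∫_I |u'(t)|² dt + ε^{2k−1} ∫_I |u^{(k)}(t)|² dt ) + R_k · (∫_I |u'(t)|² dt) / |I|^{2(ℓ−1)}, where |I| is the length of I. -/
open Real Filter Topology Set MeasureTheory intervalIntegral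

lemma sq_integral_le_length_mul_integral_sq {a b : ℝ} (hab : a < b) {f : ℝ → ℝ}
    (hf : Continuous f) :
    (∫ t in a..b, f t) ^ 2 ≤ (b - a) * ∫ t in a..b, f t ^ 2 := by
  set m := ∫ t in a..b, f t with hm
  have hL : 0 < b - a := sub_pos.2 hab
  have h0 : 0 ≤ ∫ t in a..b, ((b - a) * f t - m) ^ 2 :=
    integral_nonneg hab.le fun t _ => sq_nonneg _
  have h1 : ∫ t in a..b, ((b - a) * f t - m) ^ 2 =
      (b - a) ^ 2 * (∫ t in a..b, f t ^ 2) - 2 * (b - a) * m * m + (b - a) * m ^ 2 := by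
    have : ∀ t, ((b - a) * f t - m) ^ 2 =
        (b - a) ^ 2 * f t ^ 2 - 2 * (b - a) * m * f t + m ^ 2 := fun t => by ring
    simp_rw [this]
    rw [intervalIntegral.integral_add, intervalIntegral.integral_sub,
      intervalIntegral.integral_const_mul, intervalIntegral.integral_const_mul,
      intervalIntegral.integral_const, ← hm, smul_eq_mul]
    all_goals exact Continuous.intervalIntegrable (by fun_prop) _ _
  rw [h1] at h0
  have h2 : 0 ≤ (b - a) * ((b - a) * (∫ t in a..b, f t ^ 2) - m ^ 2) := by linarith
  have := nonneg_of_mul_nonneg_right h2 hL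
  linarith

lemma integral_sub_mul_sub (a b : ℝ) :
    ∫ s in a..b, (s - a) * (b - s) = (b - a) ^ 3 / 6 := by
  have h : ∀ s ∈ uIcc a b,
      HasDerivAt (fun s : ℝ => (b - a) * (s - a) ^ 2 / 2 - (s - a) ^ 3 / 3)
        ((s - a) * (b - s)) s := by
    intro s _
    have h1 : HasDerivAt (fun s : ℝ => s - a) 1 s := (hasDerivAt_id s).sub_const a
    have h2 := (((h1.pow 2).const_mul (b - a)).div_const 2).sub ((h1.pow 3).div_const 3)
    refine h2.congr_deriv ?_
    push_cast
    ring
  rw [integral_eq_sub_of_hasDerivAt h (Continuous.intervalIntegrable (by fun_prop) _ _)]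
  ring

lemma integral_sub_mul_sub_mul_deriv {a b : ℝ} {w w₁ : ℝ → ℝ}
    (hw : ∀ t, HasDerivAt w (w₁ t) t) (hc : Continuous w₁) :
    ∫ s in a..b, (s - a) * (b - s) * w₁ s = - ∫ s in a..b, (a + b - 2 * s) * w s := by
  have h : ∀ s ∈ uIcc a b,
      HasDerivAt (fun s : ℝ => (s - a) * (b - s)) (a + b - 2 * s) s := by
    intro s _
    have h2 := ((hasDerivAt_id s).sub_const a).mul ((hasDerivAt_id s).const_sub b)
    refine h2.congr_deriv ?_
    simp only [id]
    ring
  rw [integral_mul_deriv_eq_deriv_mul h (fun s _ => hw s)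
    (Continuous.intervalIntegrable (by fun_prop) _ _) (hc.intervalIntegrable _ _)]
  simp

lemma sq_deriv_le_of_mem_Icc {a b : ℝ} (hab : a < b) {w w₁ w₂ : ℝ → ℝ}
    (hw : ∀ t, HasDerivAt w (w₁ t) t) (hw₁ : ∀ t, HasDerivAt w₁ (w₂ t) t)
    (hw₂ : Continuous w₂) {t : ℝ} (ht : t ∈ Icc a b) :
    w₁ t ^ 2 ≤ 72 / (b - a) ^ 3 * (∫ s in a..b, w s ^ 2) +
      2 * (b - a) * ∫ s in a..b, w₂ s ^ 2 := by
  have hL : 0 < b - a := sub_pos.2 hab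
  have c0 : Continuous w := continuous_iff_continuousAt.2 fun t => (hw t).continuousAt
  have c1 : Continuous w₁ := continuous_iff_continuousAt.2 fun t => (hw₁ t).continuousAt
  set M := ∫ s in a..b, |w₂ s| with hM
  set Q := ∫ s in a..b, (a + b - 2 * s) * w s with hQ
  have hM0 : 0 ≤ M := integral_nonneg hab.le fun s _ => abs_nonneg _
  have hosc : ∀ s ∈ Icc a b, |w₁ t - w₁ s| ≤ M := by
    intro s hs
    rw [← integral_eq_sub_of_hasDerivAt (fun x _ => hw₁ x) (hw₂.intervalIntegrable s t)]
    refine (norm_integral_le_abs_integral_norm (f := w₂) (μ := volume)).trans ?_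
    rw [← abs_of_nonneg hM0, hM]
    refine abs_integral_mono_interval ?_ (Eventually.of_forall fun x => abs_nonneg _)
      (hw₂.abs.intervalIntegrable _ _)
    rw [uIoc_of_le hab.le]
    exact Ioc_subset_Ioc (le_min hs.1 ht.1) (max_le hs.2 ht.2)
  have hφ : ∀ s ∈ Icc a b, 0 ≤ (s - a) * (b - s) := fun s hs =>
    mul_nonneg (sub_nonneg.2 hs.1) (sub_nonneg.2 hs.2)
  have hdiff : ∫ s in a..b, (s - a) * (b - s) * (w₁ t - w₁ s) =
      (b - a) ^ 3 / 6 * w₁ t + Q := by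
    simp_rw [mul_sub ((_ - a) * (b - _))]
    rw [intervalIntegral.integral_sub, intervalIntegral.integral_mul_const,
      integral_sub_mul_sub, integral_sub_mul_sub_mul_deriv hw c1]
    · ring
    all_goals exact Continuous.intervalIntegrable (by fun_prop) _ _
  have hMint : ∫ s in a..b, (s - a) * (b - s) * M = (b - a) ^ 3 / 6 * M := by
    rw [intervalIntegral.integral_mul_const, integral_sub_mul_sub]
  have hup : (b - a) ^ 3 / 6 * w₁ t + Q ≤ (b - a) ^ 3 / 6 * M := by
    rw [← hdiff, ← hMint]
    refine integral_mono_on hab.le (Continuous.intervalIntegrable (by fun_prop) _ _)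
      (Continuous.intervalIntegrable (by fun_prop) _ _) fun s hs => ?_
    exact mul_le_mul_of_nonneg_left (abs_le.1 (hosc s hs)).2 (hφ s hs)
  have hlo : -((b - a) ^ 3 / 6 * M) ≤ (b - a) ^ 3 / 6 * w₁ t + Q := by
    rw [← hdiff, ← hMint, ← intervalIntegral.integral_neg]
    refine integral_mono_on hab.le (Continuous.intervalIntegrable (by fun_prop) _ _)
      (Continuous.intervalIntegrable (by fun_prop) _ _) fun s hs => ?_
    rw [← mul_neg]
    exact mul_le_mul_of_nonneg_left (abs_le.1 (hosc s hs)).1 (hφ s hs)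
  have hQ2 : Q ^ 2 ≤ (b - a) ^ 3 * ∫ s in a..b, w s ^ 2 := by
    refine (sq_integral_le_length_mul_integral_sq hab (by fun_prop)).trans ?_
    have : ∫ s in a..b, ((a + b - 2 * s) * w s) ^ 2 ≤
        ∫ s in a..b, (b - a) ^ 2 * w s ^ 2 := by
      refine integral_mono_on hab.le (Continuous.intervalIntegrable (by fun_prop) _ _)
        (Continuous.intervalIntegrable (by fun_prop) _ _) fun s hs => ?_
      rw [mul_pow]
      refine mul_le_mul_of_nonneg_right ?_ (sq_nonneg _)
      nlinarith [hφ s hs]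
    rw [intervalIntegral.integral_const_mul] at this
    calc _ ≤ (b - a) * ((b - a) ^ 2 * ∫ s in a..b, w s ^ 2) :=
          mul_le_mul_of_nonneg_left this hL.le
      _ = _ := by ring
  have hM2 : M ^ 2 ≤ (b - a) * ∫ s in a..b, w₂ s ^ 2 := by
    have := sq_integral_le_length_mul_integral_sq hab hw₂.abs
    simpa only [sq_abs] using this
  set q := 6 / (b - a) ^ 3 * Q with hq
  have h3 : 0 < (b - a) ^ 3 / 6 := by positivity
  have hqQ : Q = (b - a) ^ 3 / 6 * q := by rw [hq]; field_simp
  have hle1 : w₁ t + q ≤ M := by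
    rw [hqQ, ← mul_add] at hup
    exact le_of_mul_le_mul_left hup h3
  have hle2 : -M ≤ w₁ t + q := by
    rw [hqQ, ← mul_add, ← mul_neg] at hlo
    exact le_of_mul_le_mul_left hlo h3
  have hq2 : q ^ 2 ≤ 36 / (b - a) ^ 3 * ∫ s in a..b, w s ^ 2 := by
    calc q ^ 2 = 36 / (b - a) ^ 6 * Q ^ 2 := by rw [hq]; field_simp; ring
      _ ≤ 36 / (b - a) ^ 6 * ((b - a) ^ 3 * ∫ s in a..b, w s ^ 2) := by gcongr
      _ = _ := by field_simp
  have hsq : (w₁ t + q) ^ 2 ≤ M ^ 2 := sq_le_sq' hle2 hle1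
  have h72 : 72 / (b - a) ^ 3 * (∫ s in a..b, w s ^ 2) =
      2 * (36 / (b - a) ^ 3 * ∫ s in a..b, w s ^ 2) := by ring
  rw [h72]
  nlinarith [sq_nonneg (w₁ t + 2 * q)]

lemma integral_sq_deriv_le_of_length {a b : ℝ} (hab : a < b) {w w₁ w₂ : ℝ → ℝ}
    (hw : ∀ t, HasDerivAt w (w₁ t) t) (hw₁ : ∀ t, HasDerivAt w₁ (w₂ t) t)
    (hw₂ : Continuous w₂) :
    ∫ t in a..b, w₁ t ^ 2 ≤ 72 / (b - a) ^ 2 * (∫ s in a..b, w s ^ 2) +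
      2 * (b - a) ^ 2 * ∫ s in a..b, w₂ s ^ 2 := by
  have hL : 0 < b - a := sub_pos.2 hab
  have c1 : Continuous w₁ := continuous_iff_continuousAt.2 fun t => (hw₁ t).continuousAt
  refine (integral_mono_on hab.le (Continuous.intervalIntegrable (by fun_prop) _ _)
    (Continuous.intervalIntegrable continuous_const _ _)
    fun t ht => sq_deriv_le_of_mem_Icc hab hw hw₁ hw₂ ht).trans_eq ?_
  rw [intervalIntegral.integral_const, smul_eq_mul]
  field_simp

lemma integral_sq_deriv_le {a b δ : ℝ} (hδ : 0 < δ) (hδab : δ ≤ b - a) {w w₁ w₂ : ℝ → ℝ}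
    (hw : ∀ t, HasDerivAt w (w₁ t) t) (hw₁ : ∀ t, HasDerivAt w₁ (w₂ t) t)
    (hw₂ : Continuous w₂) :
    ∫ t in a..b, w₁ t ^ 2 ≤ 288 * (δ⁻¹ ^ 2 * (∫ s in a..b, w s ^ 2) +
      δ ^ 2 * ∫ s in a..b, w₂ s ^ 2) := by
  have hL : 0 < b - a := hδ.trans_le hδab
  have c0 : Continuous w := continuous_iff_continuousAt.2 fun t => (hw t).continuousAt
  have c1 : Continuous w₁ := continuous_iff_continuousAt.2 fun t => (hw₁ t).continuousAt
  set N := ⌈(b - a) / δ⌉₊ with hN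
  have hN0 : 0 < N := Nat.ceil_pos.2 (div_pos hL hδ)
  have hNr : (0 : ℝ) < N := Nat.cast_pos.2 hN0
  have hNge : (b - a) / δ ≤ N := Nat.le_ceil _
  have hNlt : (N : ℝ) < (b - a) / δ + 1 := Nat.ceil_lt_add_one (div_pos hL hδ).le
  set h := (b - a) / N with hh
  have hh0 : 0 < h := div_pos hL hNr
  have hhδ : h ≤ δ := by
    rw [hh, div_le_iff₀ hNr]
    rw [div_le_iff₀ hδ] at hNge
    linarith
  have hδh : δ / 2 ≤ h := by
    rw [hh, le_div_iff₀ hNr]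
    have : (N : ℝ) * δ < (b - a) + δ := by
      have := mul_lt_mul_of_pos_right hNlt hδ
      rwa [add_mul, div_mul_cancel₀ _ hδ.ne', one_mul] at this
    linarith
  set x : ℕ → ℝ := fun i => a + i * h with hx
  have hx0 : x 0 = a := by simp [hx]
  have hxN : x N = b := by simp only [hx, hh]; field_simp; ring
  have hxs : ∀ i, x (i + 1) - x i = h := fun i => by simp only [hx]; push_cast; ring
  have hsum : ∀ f : ℝ → ℝ, Continuous f →
      ∫ t in a..b, f t = ∑ i ∈ Finset.range N, ∫ t in (x i)..(x (i + 1)), f t := by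
    intro f hf
    rw [sum_integral_adjacent_intervals fun i _ => hf.intervalIntegrable _ _, hx0, hxN]
  rw [hsum (fun t => w₁ t ^ 2) (c1.pow 2), hsum (fun t => w t ^ 2) (c0.pow 2),
    hsum (fun t => w₂ t ^ 2) (hw₂.pow 2), Finset.mul_sum, Finset.mul_sum,
    ← Finset.sum_add_distrib, Finset.mul_sum]
  refine Finset.sum_le_sum fun i _ => ?_
  have hi : x i < x (i + 1) := by linarith [hxs i]
  have key := integral_sq_deriv_le_of_length hi hw hw₁ hw₂
  rw [hxs] at key
  have hA : 0 ≤ ∫ s in (x i)..(x (i + 1)), w s ^ 2 :=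
    integral_nonneg hi.le fun s _ => sq_nonneg _
  have hB : 0 ≤ ∫ s in (x i)..(x (i + 1)), w₂ s ^ 2 :=
    integral_nonneg hi.le fun s _ => sq_nonneg _
  have e1 : 72 / h ^ 2 ≤ 288 * δ⁻¹ ^ 2 := by
    calc 72 / h ^ 2 ≤ 72 / (δ / 2) ^ 2 := by gcongr
      _ = 288 * δ⁻¹ ^ 2 := by field_simp; norm_num
  have e2 : 2 * h ^ 2 ≤ 288 * δ ^ 2 := by
    have : h ^ 2 ≤ δ ^ 2 := by gcongr
    nlinarith [sq_nonneg δ]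
  calc _ ≤ _ := key
    _ ≤ 288 * δ⁻¹ ^ 2 * (∫ s in (x i)..(x (i + 1)), w s ^ 2) +
        288 * δ ^ 2 * ∫ s in (x i)..(x (i + 1)), w₂ s ^ 2 := by gcongr
    _ = _ := by ring

/-- Three-term weighted interpolation of a real sequence up to index `n`. -/
def ThreeTermInterpolation (C : ℝ) (n : ℕ) (s : ℕ → ℝ) : Prop :=
  ∀ m, m + 2 ≤ n → ∀ η : ℝ, 0 < η → η ≤ 1 →
    s (m + 1) ≤ C * (η⁻¹ ^ 2 * s m + η ^ 2 * s (m + 2))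

lemma ThreeTermInterpolation.le_zero_add_succ {C : ℝ} (hC : 1 ≤ C) (n m : ℕ) :
    m + 1 ≤ n → ∀ η : ℝ, 0 < η → η ≤ 1 → ∃ K : ℝ, 0 ≤ K ∧ ∀ s : ℕ → ℝ, (∀ i, 0 ≤ s i) →
      ThreeTermInterpolation C n s → s m ≤ K * s 0 + η * s (m + 1) := by
  induction m with
  | zero =>
    intro _ η hη _
    refine ⟨1, zero_le_one, fun s hs _ => ?_⟩
    have := mul_nonneg hη.le (hs (0 + 1))
    linarith
  | succ m ih =>
    intro hm η hη hη1
    set θ := η / (2 * C) with hθ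
    have hC0 : 0 < C := by linarith
    have hθ0 : 0 < θ := by positivity
    have hθ1 : θ ≤ 1 := by
      rw [hθ, div_le_one (by positivity)]
      linarith
    set τ := θ ^ 2 / (2 * C) with hτ
    have hτ0 : 0 < τ := by positivity
    have hτ1 : τ ≤ 1 := by
      rw [hτ, div_le_one (by positivity)]
      nlinarith
    obtain ⟨K, hK, H⟩ := ih (by omega) τ hτ0 hτ1
    refine ⟨2 * C * θ⁻¹ ^ 2 * K, by positivity, fun s hs hI => ?_⟩
    have h1 := H s hs hI
    have h2 := hI m (by omega) θ hθ0 hθ1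
    have h3 : C * (θ⁻¹ ^ 2 * s m + θ ^ 2 * s (m + 2)) ≤
        C * (θ⁻¹ ^ 2 * (K * s 0 + τ * s (m + 1)) + θ ^ 2 * s (m + 2)) := by gcongr
    have h4 : C * (θ⁻¹ ^ 2 * (K * s 0 + τ * s (m + 1)) + θ ^ 2 * s (m + 2)) =
        C * θ⁻¹ ^ 2 * K * s 0 + s (m + 1) / 2 + C * θ ^ 2 * s (m + 2) := by
      rw [hτ]; field_simp
    have h5 : 2 * C * θ ^ 2 ≤ η := by
      have : 2 * C * θ = η := by rw [hθ]; field_simp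
      nlinarith
    have h6 := mul_le_mul_of_nonneg_right h5 (hs (m + 2))
    change s (m + 1) ≤ 2 * C * θ⁻¹ ^ 2 * K * s 0 + η * s (m + 2)
    linarith

lemma ThreeTermInterpolation.exists_le_zero_add_last {C : ℝ} (hC : 1 ≤ C) (n : ℕ) :
    ∃ K : ℝ, 1 ≤ K ∧ ∀ s : ℕ → ℝ, (∀ i, 0 ≤ s i) → ThreeTermInterpolation C n s →
      ∀ j ≤ n, s j ≤ K * s 0 + s n := by
  have h := fun m (hm : m + 1 ≤ n) =>
    ThreeTermInterpolation.le_zero_add_succ hC n m hm 1 one_pos le_rfl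
  have h' : ∀ m, ∃ K : ℝ, 0 ≤ K ∧ (m + 1 ≤ n → ∀ s : ℕ → ℝ, (∀ i, 0 ≤ s i) →
      ThreeTermInterpolation C n s → s m ≤ K * s 0 + 1 * s (m + 1)) := by
    intro m
    by_cases hm : m + 1 ≤ n
    · obtain ⟨K, hK, H⟩ := h m hm
      exact ⟨K, hK, fun _ => H⟩
    · exact ⟨0, le_rfl, fun hm' => absurd hm' hm⟩
  choose K hK0 hK using h'
  have hS : ∀ j, 0 ≤ ∑ i ∈ Finset.range j, K i := fun j => Finset.sum_nonneg fun i _ => hK0 i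
  refine ⟨1 + ∑ i ∈ Finset.range n, K i, by linarith [hS n], fun s hs hI j hj => ?_⟩
  have step : ∀ m, j ≤ m → m ≤ n → s j ≤ (∑ i ∈ Finset.range m, K i) * s 0 + s m := by
    intro m hm
    induction m, hm using Nat.le_induction with
    | base =>
      intro _
      linarith [mul_nonneg (hS j) (hs 0)]
    | succ m _ ih =>
      intro hmn
      have h1 := ih (by omega)
      have h2 := hK m hmn s hs hI
      rw [Finset.sum_range_succ, add_mul]
      linarith
  linarith [step n hj le_rfl, hs 0]

lemma exists_integral_sq_iteratedDeriv_le (n : ℕ) :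
    ∃ K : ℝ, 1 ≤ K ∧ ∀ j ≤ n, ∀ δ : ℝ, 0 < δ → ∀ a b : ℝ, a < b →
      ∀ v : ℝ → ℝ, ContDiff ℝ n v →
        ∫ t in a..b, iteratedDeriv j v t ^ 2 ≤
          K * (δ⁻¹ ^ (2 * j) + (b - a)⁻¹ ^ (2 * j)) * (∫ t in a..b, v t ^ 2) +
            δ ^ (2 * (n - j)) * ∫ t in a..b, iteratedDeriv n v t ^ 2 := by
  obtain ⟨K, hK, H⟩ :=
    ThreeTermInterpolation.exists_le_zero_add_last (C := 288) (by norm_num) n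
  refine ⟨K, hK, fun j hj δ hδ a b hab v hv => ?_⟩
  have hL : 0 < b - a := sub_pos.2 hab
  set r := min δ (b - a) with hr
  have hr0 : 0 < r := lt_min hδ hL
  have hI : ∀ i, 0 ≤ ∫ t in a..b, iteratedDeriv i v t ^ 2 := fun i =>
    integral_nonneg hab.le fun s _ => sq_nonneg _
  have hd : ∀ i < n, ∀ t, HasDerivAt (iteratedDeriv i v) (iteratedDeriv (i + 1) v t) t := by
    intro i hi t
    rw [iteratedDeriv_succ]
    exact (hv.differentiable_iteratedDeriv i (by exact_mod_cast hi) t).hasDerivAt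
  have h := H (fun i => r ^ (2 * i) * ∫ t in a..b, iteratedDeriv i v t ^ 2)
    (fun i => mul_nonneg (by positivity) (hI i)) (by
      intro m hm η hη hη1
      have key := integral_sq_deriv_le (δ := η * r) (by positivity)
        ((mul_le_of_le_one_left hr0.le hη1).trans (min_le_right _ _))
        (hd m (by omega)) (hd (m + 1) (by omega))
        (hv.continuous_iteratedDeriv (m + 2) (by exact_mod_cast hm))
      have := mul_le_mul_of_nonneg_left key (by positivity : 0 ≤ r ^ (2 * (m + 1)))
      refine this.trans_eq ?_
      simp only [mul_add, pow_add, mul_one]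
      field_simp
      ring) j hj
  simp only [mul_zero, pow_zero, one_mul, iteratedDeriv_zero] at h
  set A := ∫ t in a..b, v t ^ 2 with hA
  set B := ∫ t in a..b, iteratedDeriv n v t ^ 2 with hB
  have hA0 : 0 ≤ A := by simpa only [iteratedDeriv_zero] using hI 0
  have hB0 : 0 ≤ B := hI n
  have h1 : ∫ t in a..b, iteratedDeriv j v t ^ 2 ≤
      K * r⁻¹ ^ (2 * j) * A + r ^ (2 * (n - j)) * B := by
    have hpow : r ^ (2 * n) = r ^ (2 * j) * r ^ (2 * (n - j)) := by
      rw [← pow_add]; congr 1; omega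
    refine le_of_mul_le_mul_left (h.trans_eq ?_) (by positivity : 0 < r ^ (2 * j))
    rw [hpow, inv_pow]
    field_simp
  refine h1.trans ?_
  have h2 : r⁻¹ ^ (2 * j) ≤ δ⁻¹ ^ (2 * j) + (b - a)⁻¹ ^ (2 * j) := by
    have p1 : 0 ≤ δ⁻¹ ^ (2 * j) := by positivity
    have p2 : 0 ≤ (b - a)⁻¹ ^ (2 * j) := by positivity
    rcases min_choice δ (b - a) with e | e
    · rw [hr, e]; linarith
    · rw [hr, e]; linarith
  have h3 : r ^ (2 * (n - j)) ≤ δ ^ (2 * (n - j)) := by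
    gcongr
    exact min_le_left _ _
  gcongr

theorem stmt_2 (k : ℕ) (hk : 3 ≤ k) :
    ∃ R : ℝ, 0 < R ∧
      ∀ ℓ : ℕ, 2 ≤ ℓ → ℓ ≤ k - 1 →
      ∀ p : ℝ, 0 < p →
      ∀ ε ∈ Set.Ioo (0:ℝ) 1,
      ∀ a b : ℝ, a < b →
      ∀ u : ℝ → ℝ, ContDiff ℝ (k : ℕ∞) u →
        (∫ t in a..b, (iteratedDeriv ℓ u t) ^ 2) ≤
          R * ε ^ (1 - 2 * (ℓ:ℝ) - 2 * p * ((k:ℝ) - (ℓ:ℝ)) / ((k:ℝ) - 1)) *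
            (ε ^ (1 - 2 * p) * (∫ t in a..b, (deriv u t) ^ 2) +
              ε ^ (2 * k - 1) * ∫ t in a..b, (iteratedDeriv k u t) ^ 2) +
          R * (∫ t in a..b, (deriv u t) ^ 2) / (b - a) ^ (2 * (ℓ - 1)) := by
  obtain ⟨n, rfl⟩ : ∃ n, k = n + 1 := ⟨k - 1, by omega⟩
  obtain ⟨K, hK, H⟩ := exists_integral_sq_iteratedDeriv_le n
  refine ⟨K, by linarith, fun ℓ hℓ hℓk p hp ε hε a b hab u hu => ?_⟩
  obtain ⟨j, rfl⟩ : ∃ j, ℓ = j + 1 := ⟨ℓ - 1, by omega⟩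
  obtain ⟨d, rfl⟩ : ∃ d, n = j + d := ⟨n - j, by omega⟩
  obtain ⟨hε0, hε1⟩ := hε
  have hv : ContDiff ℝ (j + d : ℕ) (deriv u) := by
    have : ContDiff ℝ ((j + d : ℕ) + 1) u := by exact_mod_cast hu
    exact (contDiff_succ_iff_deriv.1 this).2.2
  have hn : (0 : ℝ) < j + d := by
    have : 0 < j + d := by omega
    exact_mod_cast this
  have key := H j (by omega) (ε ^ (1 - p / (j + d : ℝ))) (rpow_pos_of_pos hε0 _) a b hab _ hv
  rw [← iteratedDeriv_succ', ← iteratedDeriv_succ', Nat.add_sub_cancel_left] at key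
  refine key.trans ?_
  set A := ∫ t in a..b, deriv u t ^ 2 with hA
  set B := ∫ t in a..b, iteratedDeriv (j + d + 1) u t ^ 2 with hB
  have hA0 : 0 ≤ A := integral_nonneg hab.le fun s _ => sq_nonneg _
  have hB0 : 0 ≤ B := integral_nonneg hab.le fun s _ => sq_nonneg _
  set σ : ℝ := 1 - 2 * ((j + 1 : ℕ) : ℝ) -
    2 * p * (((j + d + 1 : ℕ) : ℝ) - ((j + 1 : ℕ) : ℝ)) / (((j + d + 1 : ℕ) : ℝ) - 1) with hσ
  have hσ' : σ = -1 - 2 * j - 2 * p * d / (j + d) := by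
    rw [hσ]
    push_cast
    congr 1
    · ring
    · congr 1 <;> ring
  have h1 : (ε ^ (1 - p / (j + d : ℝ)))⁻¹ ^ (2 * j) ≤ ε ^ σ * ε ^ (1 - 2 * p) := by
    rw [← rpow_neg hε0.le, ← rpow_natCast, ← rpow_mul hε0.le, ← rpow_add hε0]
    refine rpow_le_rpow_of_exponent_ge hε0 hε1.le ?_
    rw [hσ']
    push_cast
    have e1 : 0 ≤ p * d / (j + d) := by positivity
    have e2 : 0 ≤ p * j / (j + d) := by positivity
    have e3 : -(1 - p / (j + d : ℝ)) * (2 * j) = -2 * j + 2 * (p * j / (j + d)) := by ring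
    have e4 : 2 * p * d / (j + d : ℝ) = 2 * (p * d / (j + d)) := by ring
    rw [e3, e4]
    linarith
  have h2 : (ε ^ (1 - p / (j + d : ℝ))) ^ (2 * d) = ε ^ σ * ε ^ (2 * (j + d + 1) - 1) := by
    rw [← rpow_natCast, ← rpow_natCast ε, ← rpow_mul hε0.le, ← rpow_add hε0]
    congr 1
    rw [hσ', Nat.cast_sub (by omega)]
    push_cast
    ring
  have hKB : ε ^ σ * ε ^ (2 * (j + d + 1) - 1) * B ≤
      K * (ε ^ σ * ε ^ (2 * (j + d + 1) - 1) * B) :=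
    le_mul_of_one_le_left (by positivity) hK
  have hKA : K * (ε ^ (1 - p / (j + d : ℝ)))⁻¹ ^ (2 * j) * A ≤
      K * (ε ^ σ * ε ^ (1 - 2 * p)) * A := by gcongr
  have hLA : K * A / (b - a) ^ (2 * (j + 1 - 1)) = K * (b - a)⁻¹ ^ (2 * j) * A := by
    rw [Nat.add_sub_cancel, inv_pow]
    ring
  rw [hLA, h2]
  linarith
end

section
/- Let k ≥ 3 and N ≥ 1 be integers, let S > 0, and let p : (0,1) → (0,∞) be an admissible exponent family with c_ε := ε^{p(ε)}. Then there exist a constant C > 0 (depending only on k, N, S) and ε₀ ∈ (0,1) such that for every ε ∈ (0,ε₀), every u : ℝ → ℝ of class C^k with G_{ε,p(ε)}(u) ≤ S, and every open interval I ⊆ (0,1) satisfying (i) |u'(t)| < c_ε/ε for all t ∈ I, and (ii) the set {t ∈ I : |u^{(ℓ)}(t)| < 1/(N·ε^ℓ) for all ℓ ∈ {2,…,k−1}} has Lebesgue measure zero, one has |I| ≤ C·ε^{1+p(ε)/(k−1)}. -/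
open Real Filter Topology Set MeasureTheory intervalIntegral

/-- The truncated-quadratic singular-perturbation energy
`G_{ε,p}(u) = ∫_0^1 min{ε^{1-2p} u'(t)², 1/ε} dt + ε^{2k-1} ∫_0^1 (u^{(k)}(t))² dt`. -/
noncomputable def Gen (k : ℕ) (ε p : ℝ) (u : ℝ → ℝ) : ℝ :=
  (∫ t in (0:ℝ)..1, min (ε ^ (1 - 2 * p) * (deriv u t) ^ 2) (1 / ε)) +
    ε ^ (2 * k - 1) * ∫ t in (0:ℝ)..1, (iteratedDeriv k u t) ^ 2

/-- A function with `∫₀¹ f² ≤ 1` whose first `j` derivatives exist has, in every subinterval of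
length `d`, a point where its `j`-th derivative is bounded by a constant depending on `j, d`. -/
lemma exists_abs_deriv_le_of_integral_sq_le_one (j : ℕ) :
    ∀ d : ℝ, 0 < d → ∃ B : ℝ, 0 < B ∧ ∀ D : ℕ → ℝ → ℝ,
      (∀ i < j, ∀ x, HasDerivAt (D i) (D (i + 1) x) x) → Continuous (D 0) →
      (∫ x in (0:ℝ)..1, D 0 x ^ 2) ≤ 1 →
      ∀ s : ℝ, 0 ≤ s → s + d ≤ 1 → ∃ x ∈ Icc s (s + d), |D j x| ≤ B := by
  induction j with
  | zero =>
    intro d hd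
    refine ⟨1 / d + 1, by positivity, fun D _ hc hint s hs hsd ↦ ?_⟩
    by_contra! hcon
    have hB : 1 < d * (1 / d + 1) ^ 2 := by
      have : d * (1 / d + 1) ^ 2 = 1 / d + 2 + d := by field_simp; ring
      rw [this]; have : 0 < 1 / d := by positivity
      linarith
    have hsub : ∫ x in s..(s + d), D 0 x ^ 2 ≤ ∫ x in (0:ℝ)..1, D 0 x ^ 2 :=
      integral_mono_interval hs (by linarith) hsd (ae_of_all _ fun x ↦ sq_nonneg _)
        ((hc.pow 2).intervalIntegrable _ _)
    have hlow : ∫ _ in s..(s + d), (1 / d + 1) ^ 2 ≤ ∫ x in s..(s + d), D 0 x ^ 2 := by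
      refine integral_mono_on (by linarith) (by simp) ((hc.pow 2).intervalIntegrable _ _) ?_
      intro x hx
      rw [← sq_abs (D 0 x)]
      have := hcon x hx
      gcongr
    simp only [intervalIntegral.integral_const, smul_eq_mul, add_sub_cancel_left] at hlow
    linarith
  | succ j ih =>
    intro d hd
    obtain ⟨B, hB, h⟩ := ih (d / 3) (by positivity)
    refine ⟨2 * B / (d / 3), by positivity, fun D hD hc hint s hs hsd ↦ ?_⟩
    have hD' : ∀ i < j, ∀ x, HasDerivAt (D i) (D (i + 1) x) x := fun i hi ↦ hD i (by omega)
    obtain ⟨x, hx, hxB⟩ := h D hD' hc hint s hs (by linarith)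
    obtain ⟨y, hy, hyB⟩ := h D hD' hc hint (s + 2 * d / 3) (by positivity) (by linarith)
    have hxy : d / 3 ≤ y - x := by linarith [hx.2, hy.1]
    obtain ⟨z, hz, hzeq⟩ := exists_hasDerivAt_eq_slope (D j) (D (j + 1)) (by linarith : x < y)
      (fun t _ ↦ (hD j (by omega) t).continuousAt.continuousWithinAt)
      (fun t _ ↦ hD j (by omega) t)
    refine ⟨z, ⟨by linarith [hx.1, hz.1], by linarith [hy.2, hz.2]⟩, ?_⟩
    rw [hzeq, abs_div, abs_of_pos (by linarith : 0 < y - x)]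
    gcongr
    calc |D j y - D j x| ≤ |D j y| + |D j x| := abs_sub _ _
      _ ≤ 2 * B := by linarith

/-- Interpolation on the unit interval: `L²` bounds on a function and on its `m`-th derivative
bound all intermediate derivatives uniformly. -/
lemma exists_forall_abs_deriv_le (m : ℕ) :
    ∃ A : ℝ, 0 < A ∧ ∀ D : ℕ → ℝ → ℝ,
      (∀ i < m, ∀ x, HasDerivAt (D i) (D (i + 1) x) x) → Continuous (D 0) → Continuous (D m) →
      (∫ x in (0:ℝ)..1, D 0 x ^ 2) ≤ 1 → (∫ x in (0:ℝ)..1, D m x ^ 2) ≤ 1 →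
      ∀ i < m, ∀ x ∈ Icc (0:ℝ) 1, |D i x| ≤ A := by
  choose B hB hBD using fun j ↦ exists_abs_deriv_le_of_integral_sq_le_one j 1 one_pos
  refine ⟨1 + ∑ i ∈ Finset.range m, B i,
    add_pos_of_pos_of_nonneg one_pos (Finset.sum_nonneg fun i _ ↦ (hB i).le), ?_⟩
  intro D hD hc0 hcm h0 hm
  have hpt : ∀ i < m, ∃ y ∈ Icc (0:ℝ) 1, |D i y| ≤ B i := fun i hi ↦ by
    simpa using hBD i D (fun l hl ↦ hD l (by omega)) hc0 h0 0 le_rfl (by norm_num)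
  have key : ∀ n, ∀ i, i + n + 1 = m → ∀ x ∈ Icc (0:ℝ) 1,
      |D i x| ≤ 1 + ∑ l ∈ Finset.Ico i m, B l := by
    intro n
    induction n with
    | zero =>
      rintro i rfl x hx
      obtain ⟨y, hy, hyB⟩ := hpt i (by omega)
      have hftc : ∫ t in y..x, D (i + 1) t = D i x - D i y :=
        integral_eq_sub_of_hasDerivAt (fun t _ ↦ hD i (by omega) t) (hcm.intervalIntegrable _ _)
      have hle : |∫ t in y..x, D (i + 1) t| ≤ ∫ t in (0:ℝ)..1, (1 + D (i + 1) t ^ 2) / 2 := by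
        have hcont : Continuous fun t ↦ (1 + D (i + 1) t ^ 2) / 2 :=
          (continuous_const.add (hcm.pow 2)).div_const _
        calc |∫ t in y..x, D (i + 1) t| ≤ |∫ t in y..x, (1 + D (i + 1) t ^ 2) / 2| := by
              rw [← Real.norm_eq_abs (∫ t in y..x, D (i + 1) t)]
              refine intervalIntegral.norm_integral_le_abs_of_norm_le (ae_of_all _ fun t ↦ ?_)
                (hcont.intervalIntegrable _ _)
              rw [Real.norm_eq_abs]
              nlinarith [sq_nonneg (|D (i + 1) t| - 1), sq_abs (D (i + 1) t)]
          _ ≤ |∫ t in (0:ℝ)..1, (1 + D (i + 1) t ^ 2) / 2| := by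
              refine abs_integral_mono_interval ?_ (ae_of_all _ fun t ↦ by positivity)
                (hcont.intervalIntegrable _ _)
              rw [uIoc_of_le zero_le_one]
              exact Ioc_subset_Ioc (le_min hy.1 hx.1) (max_le hy.2 hx.2)
          _ = _ := abs_of_nonneg (integral_nonneg zero_le_one fun t _ ↦ by positivity)
      have hval : ∫ t in (0:ℝ)..1, (1 + D (i + 1) t ^ 2) / 2 ≤ 1 := by
        rw [add_zero] at hm hcm
        have hI : IntervalIntegrable (fun t ↦ D (i + 1) t ^ 2) volume 0 1 :=
          (hcm.pow 2).intervalIntegrable _ _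
        rw [intervalIntegral.integral_div, intervalIntegral.integral_add (by simp) hI]
        simp only [intervalIntegral.integral_const, smul_eq_mul]
        linarith
      rw [hftc] at hle
      have := abs_sub_abs_le_abs_sub (D i x) (D i y)
      simp
      linarith
    | succ n ih =>
      rintro i hi x hx
      obtain ⟨y, hy, hyB⟩ := hpt i (by omega)
      have hA := ih (i + 1) (by omega)
      have hmv := (convex_Icc (0:ℝ) 1).norm_image_sub_le_of_norm_hasDerivWithin_le
        (fun t _ ↦ (hD i (by omega) t).hasDerivWithinAt) hA hy hx
      have hxy : ‖x - y‖ ≤ 1 := by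
        rw [Real.norm_eq_abs, abs_le]; constructor <;> linarith [hx.1, hx.2, hy.1, hy.2]
      have hs : 0 ≤ ∑ l ∈ Finset.Ico (i + 1) m, B l := Finset.sum_nonneg fun l _ ↦ (hB l).le
      have hmul := mul_le_mul_of_nonneg_left hxy
        (by linarith : 0 ≤ 1 + ∑ l ∈ Finset.Ico (i + 1) m, B l)
      have := abs_sub_abs_le_abs_sub (D i x) (D i y)
      rw [Real.norm_eq_abs] at hmv
      rw [Finset.sum_eq_sum_Ico_succ_bot (by omega)]
      linarith
  intro i hi x hx
  refine (key (m - i - 1) i (by omega) x hx).trans ?_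
  refine add_le_add_right (Finset.sum_le_sum_of_subset_of_nonneg (fun l hl ↦ ?_)
    fun l _ _ ↦ (hB l).le) 1
  simp at hl ⊢
  omega

/-- For an admissible exponent family, every positive power of `c_ε = ε ^ p ε` vanishes as
`ε → 0⁺`. -/
lemma IsAdmissibleExponent.tendsto_rpow_div {p : ℝ → ℝ} (hp : IsAdmissibleExponent p) {r : ℝ}
    (hr : 0 < r) : Tendsto (fun ε : ℝ ↦ ε ^ (p ε / r)) (𝓝[>] 0) (𝓝 0) := by
  have hIoo : ∀ᶠ ε : ℝ in 𝓝[>] 0, ε ∈ Ioo (0:ℝ) 1 := Ioo_mem_nhdsGT one_pos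
  have hlog : Tendsto (fun ε : ℝ ↦ Real.log (-Real.log ε)) (𝓝[>] 0) atTop :=
    Real.tendsto_log_atTop.comp (tendsto_neg_atBot_atTop.comp Real.tendsto_log_nhdsGT_zero)
  have hprod : Tendsto (fun ε : ℝ ↦ p ε * (-Real.log ε)) (𝓝[>] 0) atTop := by
    refine tendsto_atTop_mono' _ ?_ hlog
    filter_upwards [hIoo, hp.2.2.eventually_lt_const one_pos] with ε hε h
    have : 0 < p ε * (-Real.log ε) := mul_pos (hp.1 ε hε) (neg_pos.2 (Real.log_neg hε.1 hε.2))
    exact ((div_lt_one this).1 h).le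
  refine (Real.tendsto_exp_neg_atTop_nhds_zero.comp (hprod.atTop_div_const hr)).congr' ?_
  filter_upwards [hIoo] with ε hε
  rw [Function.comp_apply, Real.rpow_def_of_pos hε.1]
  congr 1
  ring

/-- Localized energy bounds on an interval where the truncation in `Gen` is inactive. -/
lemma integral_le_of_Gen_le {k : ℕ} (hk : 1 ≤ k) {ε q S : ℝ} (hε : 0 < ε) {u : ℝ → ℝ}
    (hu : ContDiff ℝ (k : ℕ∞) u) (hG : Gen k ε q u ≤ S) {a b : ℝ} (ha : 0 ≤ a) (hab : a ≤ b)
    (hb : b ≤ 1) (hsmall : ∀ t ∈ Ioc a b, |deriv u t| < ε ^ q / ε) :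
    ε ^ (1 - 2 * q) * (∫ t in a..b, deriv u t ^ 2) ≤ S ∧
      ε ^ (2 * k - 1) * (∫ t in a..b, iteratedDeriv k u t ^ 2) ≤ S := by
  have hc1 : Continuous (deriv u) := hu.continuous_deriv (by exact_mod_cast hk)
  have hck : Continuous (iteratedDeriv k u) := hu.continuous_iteratedDeriv k le_rfl
  have hcmin : Continuous fun t ↦ min (ε ^ (1 - 2 * q) * deriv u t ^ 2) (1 / ε) := by fun_prop
  have hnn : ∀ t, 0 ≤ min (ε ^ (1 - 2 * q) * deriv u t ^ 2) (1 / ε) := fun t ↦ by positivity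
  have h1 : ∫ t in a..b, min (ε ^ (1 - 2 * q) * deriv u t ^ 2) (1 / ε) ≤
      ∫ t in (0:ℝ)..1, min (ε ^ (1 - 2 * q) * deriv u t ^ 2) (1 / ε) :=
    integral_mono_interval ha hab hb (ae_of_all _ hnn) (hcmin.intervalIntegrable _ _)
  have h2 : ∫ t in a..b, iteratedDeriv k u t ^ 2 ≤ ∫ t in (0:ℝ)..1, iteratedDeriv k u t ^ 2 :=
    integral_mono_interval ha hab hb (ae_of_all _ fun t ↦ sq_nonneg _)
      ((hck.pow 2).intervalIntegrable _ _)
  have h3 : 0 ≤ ∫ t in a..b, min (ε ^ (1 - 2 * q) * deriv u t ^ 2) (1 / ε) :=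
    integral_nonneg hab fun t _ ↦ hnn t
  have h4 : 0 ≤ ∫ t in a..b, iteratedDeriv k u t ^ 2 := integral_nonneg hab fun t _ ↦ sq_nonneg _
  have h5 := mul_le_mul_of_nonneg_left h2 (pow_nonneg hε.le (2 * k - 1))
  have h6 := mul_nonneg (pow_nonneg hε.le (2 * k - 1)) h4
  have h7 : ∫ t in a..b, min (ε ^ (1 - 2 * q) * deriv u t ^ 2) (1 / ε) =
      ∫ t in a..b, ε ^ (1 - 2 * q) * deriv u t ^ 2 := by
    refine integral_congr_ae (ae_of_all _ fun t ht ↦ min_eq_left ?_)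
    rw [uIoc_of_le hab] at ht
    have hq : ε ^ (1 - 2 * q) * (ε ^ q / ε) ^ 2 = 1 / ε := by
      rw [Real.rpow_sub hε, Real.rpow_one, two_mul, Real.rpow_add hε]
      have : ε ^ q ≠ 0 := (Real.rpow_pos_of_pos hε q).ne'
      field_simp
    rw [← hq, ← sq_abs (deriv u t)]
    have := hsmall t ht
    gcongr
  rw [h7, intervalIntegral.integral_const_mul] at h1 h3
  unfold Gen at hG
  constructor <;> linarith

/-- Scaled interpolation: on an interval of length `ε * l`, energy bounds control the intermediate
derivatives. -/
lemma exists_forall_sq_iteratedDeriv_le (m : ℕ) :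
    ∃ A : ℝ, 0 < A ∧ ∀ S ε l a : ℝ, 0 < S → 0 < ε → 0 < l → l ≤ 1 → ∀ u : ℝ → ℝ,
      ContDiff ℝ ((m + 1 : ℕ) : ℕ∞) u →
      ε / l ^ (2 * m) * (∫ t in a..(a + ε * l), deriv u t ^ 2) ≤ S →
      ε ^ (2 * m + 1) * (∫ t in a..(a + ε * l), iteratedDeriv (m + 1) u t ^ 2) ≤ S →
      ∀ j < m, ∀ t ∈ Icc a (a + ε * l), (ε ^ (j + 1) * iteratedDeriv (j + 1) u t) ^ 2 ≤
        A ^ 2 * S * l := by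
  obtain ⟨A, hA, h⟩ := exists_forall_abs_deriv_le m
  refine ⟨A, hA, fun S ε l a hS hε hl hl1 u hu h1 hm j hj t ht ↦ ?_⟩
  have hh : 0 < ε * l := by positivity
  obtain ⟨κ, hκ0, hκ⟩ : ∃ κ : ℝ, 0 < κ ∧ κ ^ 2 = ε ^ 2 * l / (S * l ^ (2 * m)) :=
    ⟨√(ε ^ 2 * l / (S * l ^ (2 * m))), by positivity, Real.sq_sqrt (by positivity)⟩
  let D : ℕ → ℝ → ℝ := fun i x ↦ κ * (ε * l) ^ i * iteratedDeriv (i + 1) u (a + ε * l * x)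
  have hcont : ∀ i ≤ m, Continuous (D i) := fun i hi ↦ by
    have := hu.continuous_iteratedDeriv (i + 1) (by exact_mod_cast Nat.succ_le_succ hi)
    fun_prop
  have hint : ∀ i, ∫ x in (0:ℝ)..1, D i x ^ 2 = κ ^ 2 * (ε * l) ^ (2 * i) *
      ((ε * l)⁻¹ * ∫ t in a..(a + ε * l), iteratedDeriv (i + 1) u t ^ 2) := fun i ↦ by
    have hs := intervalIntegral.integral_comp_add_mul (a := 0) (b := 1)
      (fun t ↦ iteratedDeriv (i + 1) u t ^ 2) hh.ne' a
    simp only [mul_zero, add_zero, mul_one, smul_eq_mul] at hs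
    rw [← hs, ← intervalIntegral.integral_const_mul]
    refine intervalIntegral.integral_congr fun x _ ↦ ?_
    simp only [D]
    ring
  have hbound := h D ?_ (hcont 0 (by omega)) (hcont m le_rfl) ?_ ?_ j hj ((t - a) / (ε * l))
    ⟨div_nonneg (by linarith [ht.1]) hh.le, (div_le_one hh).2 (by linarith [ht.2])⟩
  · have harg : a + ε * l * ((t - a) / (ε * l)) = t := by field_simp; ring
    simp only [D, harg] at hbound
    have hsq := pow_le_pow_left₀ (abs_nonneg _) hbound 2
    rw [sq_abs, mul_pow, mul_pow, hκ] at hsq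
    obtain ⟨r, rfl⟩ : ∃ r, m = j + 1 + r := ⟨m - (j + 1), by omega⟩
    have hle : l ^ (2 * r + 1) ≤ l := by
      simpa using pow_le_pow_of_le_one hl.le hl1 (show 1 ≤ 2 * r + 1 by omega)
    have heq : (ε ^ (j + 1) * iteratedDeriv (j + 1) u t) ^ 2 =
        ε ^ 2 * l / (S * l ^ (2 * (j + 1 + r))) * ((ε * l) ^ j) ^ 2 *
          iteratedDeriv (j + 1) u t ^ 2 * (S * l ^ (2 * r + 1)) := by
      field_simp
      ring
    rw [heq]
    calc _ ≤ A ^ 2 * (S * l ^ (2 * r + 1)) := by gcongr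
      _ ≤ A ^ 2 * (S * l) := by gcongr
      _ = A ^ 2 * S * l := by ring
  · intro i hi x
    have hd : HasDerivAt (iteratedDeriv (i + 1) u)
        (iteratedDeriv (i + 2) u (a + ε * l * x)) (a + ε * l * x) := by
      rw [iteratedDeriv_succ (n := i + 1)]
      exact ((hu.differentiable_iteratedDeriv (i + 1)
        (by exact_mod_cast Nat.succ_lt_succ hi)) _).hasDerivAt
    have hin : HasDerivAt (fun x : ℝ ↦ a + ε * l * x) (ε * l) x := by
      simpa using ((hasDerivAt_id x).const_mul (ε * l)).const_add a
    refine ((hd.comp x hin).const_mul (κ * (ε * l) ^ i)).congr_deriv ?_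
    simp only [D]
    ring
  · rw [hint 0, hκ]
    simp only [zero_add, iteratedDeriv_one, mul_zero, pow_zero, mul_one]
    calc _ = ε / l ^ (2 * m) * (∫ t in a..(a + ε * l), deriv u t ^ 2) / S := by field_simp
      _ ≤ 1 := (div_le_one hS).2 h1
  · rw [hint m, hκ]
    calc _ = ε ^ (2 * m + 1) * (∫ t in a..(a + ε * l), iteratedDeriv (m + 1) u t ^ 2) / S := by
          field_simp
          ring
      _ ≤ 1 := (div_le_one hS).2 hm

theorem stmt_3 (k N : ℕ) (hk : 3 ≤ k) (hN : 1 ≤ N) (S : ℝ) (hS : 0 < S)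
    (p : ℝ → ℝ) (hp : IsAdmissibleExponent p) :
    ∃ C : ℝ, 0 < C ∧ ∃ ε₀ ∈ Set.Ioo (0:ℝ) 1, ∀ ε ∈ Set.Ioo (0:ℝ) ε₀,
      ∀ u : ℝ → ℝ, ContDiff ℝ (k : ℕ∞) u → Gen k ε (p ε) u ≤ S →
      ∀ a b : ℝ, a < b → Set.Ioo a b ⊆ Set.Ioo (0:ℝ) 1 →
      (∀ t ∈ Set.Ioo a b, |deriv u t| < ε ^ p ε / ε) →
      volume {t ∈ Set.Ioo a b | ∀ ℓ : ℕ, 2 ≤ ℓ → ℓ ≤ k - 1 →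
          |iteratedDeriv ℓ u t| < 1 / ((N:ℝ) * ε ^ ℓ)} = 0 →
      b - a ≤ C * ε ^ (1 + p ε / ((k:ℝ) - 1)) := by
  obtain ⟨m, rfl⟩ : ∃ m, k = m + 1 := ⟨k - 1, by omega⟩
  have hm : (0:ℝ) < m := by exact_mod_cast (by omega : 0 < m)
  have hN0 : (0:ℝ) < N := by exact_mod_cast hN
  obtain ⟨A, hA, hinterp⟩ := exists_forall_sq_iteratedDeriv_le m
  have hev : ∀ᶠ ε in 𝓝[>] (0:ℝ), A ^ 2 * S * ε ^ (p ε / m) < (1 / N) ^ 2 := by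
    have := (hp.tendsto_rpow_div hm).const_mul (A ^ 2 * S)
    rw [mul_zero] at this
    exact this.eventually_lt_const (by positivity)
  obtain ⟨δ, hδ, hδs⟩ := (mem_nhdsGT_iff_exists_Ioo_subset).1 hev
  refine ⟨1, one_pos, min δ (1 / 2),
    ⟨lt_min hδ (by norm_num), (min_le_right _ _).trans_lt (by norm_num)⟩, ?_⟩
  intro ε hε u hu hG a b hab hsub hsmall hvol
  have hε0 : 0 < ε := hε.1
  have hεδ : ε < δ := hε.2.trans_le (min_le_left _ _)
  have hε1 : ε < 1 := (hε.2.trans_le (min_le_right _ _)).trans (by norm_num)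
  have hthr : A ^ 2 * S * ε ^ (p ε / m) < (1 / N) ^ 2 := hδs ⟨hε0, hεδ⟩
  obtain ⟨ha0, hb1⟩ := (Ioo_subset_Ioo_iff hab).1 hsub
  push_cast
  rw [one_mul, add_sub_cancel_right, Real.rpow_add hε0, Real.rpow_one]
  set l := ε ^ (p ε / m) with hl
  have hl0 : 0 < l := Real.rpow_pos_of_pos hε0 _
  have hl1 : l ≤ 1 := Real.rpow_le_one hε0.le hε1.le (div_pos (hp.1 ε ⟨hε0, hε1⟩) hm).le
  have hlm : ε ^ (1 - 2 * p ε) = ε / l ^ (2 * m) := by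
    rw [Real.rpow_sub hε0, Real.rpow_one, hl, ← Real.rpow_mul_natCast hε0.le]
    congr 2
    push_cast
    field_simp
  by_contra! hlt
  obtain ⟨hE1, hEm⟩ := integral_le_of_Gen_le (by omega) hε0 hu hG ha0
    (by nlinarith : a ≤ a + ε * l) (by linarith)
    (fun t ht ↦ hsmall t ⟨ht.1, by linarith [ht.2]⟩)
  rw [hlm] at hE1
  rw [show 2 * (m + 1) - 1 = 2 * m + 1 by omega] at hEm
  have hder := hinterp S ε l a hS hε0 hl0 hl1 u hu hE1 hEm
  have hsubset : Ioo a (a + ε * l) ⊆ {t ∈ Set.Ioo a b | ∀ ℓ : ℕ, 2 ≤ ℓ → ℓ ≤ m + 1 - 1 →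
      |iteratedDeriv ℓ u t| < 1 / ((N:ℝ) * ε ^ ℓ)} := by
    refine fun t ht ↦ ⟨⟨ht.1, by linarith [ht.2]⟩, fun ℓ h2 hℓ ↦ ?_⟩
    obtain ⟨j, rfl⟩ : ∃ j, ℓ = j + 1 := ⟨ℓ - 1, by omega⟩
    have hlt' := abs_lt_of_sq_lt_sq
      ((hder j (by omega) t (Ioo_subset_Icc_self ht)).trans_lt hthr) (by positivity)
    rw [abs_mul, abs_of_pos (pow_pos hε0 _)] at hlt'
    rw [← div_div, lt_div_iff₀ (pow_pos hε0 _), mul_comm]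
    exact hlt'
  have hzero := measure_mono_null hsubset hvol
  rw [Real.volume_Ioo, ENNReal.ofReal_eq_zero] at hzero
  linarith [mul_pos hε0 hl0]
end

section
/- Let k ≥ 2 and N ≥ 1 be integers and let θ > 0. For T > 0 and z ∈ ℝ define M(T,z) := inf{ ∫_0^T |v^{(k)}(t)|² dt : v : ℝ → ℝ of class C^k, v(T) − v(0) = z, and |v^{(ℓ)}(0)| ≤ 1/N, |v^{(ℓ)}(T)| ≤ 1/N for all ℓ ∈ {1,…,ℓ(k)} }. Then for every pair of sequences (T_n) and (z_n) with T_n > 0, T_n → 0, and |z_n| ≥ θ for all n, one has M(T_n, z_n) → +∞ as n → ∞. -/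
open Real Filter Topology Set MeasureTheory intervalIntegral

/-- `M(T,z)`: infimum of `∫_0^T |v^{(k)}|²` over `C^k` functions with `v(T) - v(0) = z` and
`|v^{(ℓ)}(0)|, |v^{(ℓ)}(T)| ≤ 1/N` for all `ℓ ∈ {1,…,ℓ(k)}`, where `ℓ(k) = ⌊k/2⌋`. -/
noncomputable def Mfun (k N : ℕ) (T z : ℝ) : ℝ :=
  sInf {E : ℝ | ∃ v : ℝ → ℝ, ContDiff ℝ (k : ℕ∞) v ∧ v T - v 0 = z ∧
    (∀ ℓ : ℕ, 1 ≤ ℓ → ℓ ≤ k / 2 →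
      |iteratedDeriv ℓ v 0| ≤ 1 / (N:ℝ) ∧ |iteratedDeriv ℓ v T| ≤ 1 / (N:ℝ)) ∧
    E = ∫ t in (0:ℝ)..T, (iteratedDeriv k v t) ^ 2}

open Polynomial in
/-- Antiderivative form of the `n`-fold integration by parts of `w⁽ⁿ⁾` against a polynomial. -/
theorem hasDerivAt_sum_iteratedDeriv_mul_polynomial {w : ℝ → ℝ} (n : ℕ)
    (hw : ContDiff ℝ (n : ℕ∞) w) (q : ℝ[X]) (t : ℝ) :
    HasDerivAt (fun t => ∑ j ∈ Finset.range n,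
        (-1) ^ j * iteratedDeriv (n - 1 - j) w t * (derivative^[j] q).eval t)
      (iteratedDeriv n w t * q.eval t - (-1) ^ n * w t * (derivative^[n] q).eval t) t := by
  induction n generalizing q with
  | zero => simpa using hasDerivAt_const t (0 : ℝ)
  | succ n ih =>
    have hwn : ContDiff ℝ (n : ℕ∞) w := hw.of_le (by exact_mod_cast Nat.le_succ n)
    have hd : HasDerivAt (iteratedDeriv n w) (iteratedDeriv (n + 1) w t) t := by
      rw [iteratedDeriv_succ]
      exact (hw.differentiable_iteratedDeriv n
        (by exact_mod_cast Nat.lt_succ_self n) t).hasDerivAt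
    have h := (hd.mul (q.hasDerivAt t)).sub (ih hwn (derivative q))
    refine (h.congr_deriv ?_).congr_of_eventuallyEq (Eventually.of_forall fun s => ?_)
    · simp only [Function.iterate_succ_apply]
      ring
    · simp only [Finset.sum_range_succ', Pi.sub_apply, Pi.mul_apply]
      have : ∀ j, n + 1 - 1 - (j + 1) = n - 1 - j := fun j => by omega
      simp only [this, Function.iterate_succ_apply, pow_succ]
      simp [sub_eq_add_neg, add_comm]

open Polynomial in
/-- Vanishing of the low-order derivatives of a polynomial at a multiple root. -/
theorem eval_iterate_derivative_eq_zero_of_pow_dvd {p q : ℝ[X]} {r j : ℕ} {t : ℝ}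
    (hp : p.eval t = 0) (hdvd : p ^ r ∣ q) (hj : j < r) : (derivative^[j] q).eval t = 0 := by
  have h := pow_sub_dvd_iterate_derivative_of_pow_dvd j hdvd
  obtain ⟨s, hs⟩ := (dvd_pow_self p (by omega : r - j ≠ 0)).trans h
  rw [hs, eval_mul, hp, zero_mul]

open Polynomial in
theorem natDegree_X_pow_mul_one_sub_X_pow (m r : ℕ) :
    (X ^ m * (1 - X) ^ r : ℝ[X]).natDegree = m + r := by
  have h : (1 - X : ℝ[X]).natDegree = 1 := by
    rw [← neg_sub, natDegree_neg, ← C_1, natDegree_X_sub_C]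
  have h0 : (1 - X : ℝ[X]) ≠ 0 := fun h' => by simp [h'] at h
  rw [natDegree_mul (pow_ne_zero _ X_ne_zero) (pow_ne_zero _ h0), natDegree_X_pow,
    natDegree_pow, h, mul_one]

open Polynomial in
theorem iterate_derivative_natDegree_self (q : ℝ[X]) :
    derivative^[q.natDegree] q = C ((q.natDegree.factorial : ℝ) * q.leadingCoeff) := by
  rw [eq_C_of_natDegree_le_zero ((natDegree_iterate_derivative q _).trans (by simp)),
    coeff_iterate_derivative]
  rw [zero_add, Nat.descFactorial_self, nsmul_eq_mul, coeff_natDegree]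

/-- The increment over a short interval is controlled by the length and the energy. -/
theorem exists_increment_le (k : ℕ) (hk : 2 ≤ k) : ∃ c > (0:ℝ), ∃ C : ℝ, ∀ (v : ℝ → ℝ) (T : ℝ),
    0 < T → T ≤ 1 → ContDiff ℝ (k : ℕ∞) v →
    (∀ ℓ : ℕ, 1 ≤ ℓ → ℓ ≤ k / 2 → |iteratedDeriv ℓ v 0| ≤ 1 ∧ |iteratedDeriv ℓ v T| ≤ 1) →
    c * |v T - v 0| ≤ C * T + T * ∫ t in (0:ℝ)..T, (iteratedDeriv k v t) ^ 2 := by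
  obtain ⟨d, rfl⟩ : ∃ d, k = d + 1 := ⟨k - 1, by omega⟩
  set m := (d + 1) / 2 with hm
  set r := d - m with hr
  have hmr : m + r = d := by omega
  set q : Polynomial ℝ := Polynomial.X ^ m * (1 - Polynomial.X) ^ r with hq
  have hdeg : q.natDegree = d := (natDegree_X_pow_mul_one_sub_X_pow m r).trans hmr
  have hq0 : q ≠ 0 := fun h => by rw [h, Polynomial.natDegree_zero] at hdeg; omega
  set c : ℝ := (d.factorial : ℝ) * q.leadingCoeff with hc
  have hc0 : c ≠ 0 := mul_ne_zero (by exact_mod_cast d.factorial_ne_zero)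
    (Polynomial.leadingCoeff_ne_zero.2 hq0)
  have hqd : Polynomial.derivative^[d] q = Polynomial.C c := by
    have := iterate_derivative_natDegree_self q
    rwa [hdeg] at this
  have hqd1 : Polynomial.derivative^[d + 1] q = 0 :=
    Polynomial.iterate_derivative_eq_zero (by omega)
  let D : ℝ → ℝ := fun t => ∑ j ∈ Finset.range d, |(Polynomial.derivative^[j] q).eval t|
  refine ⟨|c|, abs_pos.2 hc0, D 0 + D 1 + 1, fun v T hT hT1 hv hbd => ?_⟩
  set w : ℝ → ℝ := fun s => v (T * s) with hw
  have hwC : ContDiff ℝ ((d + 1 : ℕ) : ℕ∞) w := hv.comp (contDiff_const.mul contDiff_id)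
  have hwder : ∀ i ≤ d + 1, ∀ s, iteratedDeriv i w s = T ^ i * iteratedDeriv i v (T * s) :=
    fun i hi s => congrFun (iteratedDeriv_comp_const_mul
      (hv.of_le (by exact_mod_cast hi)) T) s
  -- the boundary terms of positive order
  let B : ℝ → ℝ := fun t => ∑ j ∈ Finset.range d,
    (-1) ^ j * iteratedDeriv (d - j) w t * (Polynomial.derivative^[j] q).eval t
  have hB : ∀ t, (t = 0 ∨ t = 1) → |B t| ≤ D t * T := by
    intro t ht
    rw [Finset.sum_mul]
    refine (Finset.abs_sum_le_sum_abs _ _).trans (Finset.sum_le_sum fun j hj => ?_)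
    have hjd := Finset.mem_range.1 hj
    rw [abs_mul, abs_mul, abs_pow, abs_neg, abs_one, one_pow, one_mul, mul_comm]
    by_cases hjr : j < r
    · have : (Polynomial.derivative^[j] q).eval t = 0 := by
        rcases ht with rfl | rfl
        · exact eval_iterate_derivative_eq_zero_of_pow_dvd (p := Polynomial.X) (by simp)
            (Dvd.dvd.mul_right dvd_rfl _) (by omega : j < m)
        · exact eval_iterate_derivative_eq_zero_of_pow_dvd (p := 1 - Polynomial.X) (by simp)
            (Dvd.dvd.mul_left dvd_rfl _) hjr
      simp [this]
    · refine mul_le_mul_of_nonneg_left ?_ (abs_nonneg _)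
      have h1 : |iteratedDeriv (d - j) v (T * t)| ≤ 1 := by
        have := hbd (d - j) (by omega) (by omega)
        rcases ht with rfl | rfl
        · simpa using this.1
        · simpa using this.2
      rw [hwder _ (by omega), abs_mul, abs_of_nonneg (by positivity)]
      calc T ^ (d - j) * |iteratedDeriv (d - j) v (T * t)| ≤ T ^ (d - j) * 1 := by gcongr
        _ ≤ T := by
          rw [mul_one]
          exact pow_le_of_le_one hT.le hT1 (by omega)
  have hcont : Continuous (iteratedDeriv (d + 1) w) :=
    hwC.continuous_iteratedDeriv _ le_rfl
  have hcontv : Continuous (iteratedDeriv (d + 1) v) :=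
    hv.continuous_iteratedDeriv _ le_rfl
  have hFTC := intervalIntegral.integral_eq_sub_of_hasDerivAt
    (fun t _ => (hasDerivAt_sum_iteratedDeriv_mul_polynomial (d + 1) hwC q t).congr_deriv
      (show _ = iteratedDeriv (d + 1) w t * q.eval t by
        rw [hqd1, Polynomial.eval_zero, mul_zero, sub_zero]))
    ((hcont.mul q.continuous).intervalIntegrable 0 1)
  simp only [Finset.sum_range_succ, Nat.add_sub_cancel, Nat.sub_self, iteratedDeriv_zero, hqd,
    Polynomial.eval_C] at hFTC
  change _ = B 1 + _ - (B 0 + _) at hFTC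
  have hid : (-1) ^ d * (c * (v T - v 0)) =
      (∫ t in (0:ℝ)..1, iteratedDeriv (d + 1) w t * q.eval t) - B 1 + B 0 := by
    rw [hFTC, hw]
    simp only [mul_one, mul_zero]
    ring
  -- the volume term
  have hI : |∫ t in (0:ℝ)..1, iteratedDeriv (d + 1) w t * q.eval t| ≤
      T + T * ∫ t in (0:ℝ)..T, (iteratedDeriv (d + 1) v t) ^ 2 := by
    have hcs : Continuous fun s => (iteratedDeriv (d + 1) v (T * s)) ^ 2 := by fun_prop
    have hle : |∫ t in (0:ℝ)..1, iteratedDeriv (d + 1) w t * q.eval t| ≤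
        ∫ s in (0:ℝ)..1, T ^ 2 * (1 + (iteratedDeriv (d + 1) v (T * s)) ^ 2) := by
      rw [← Real.norm_eq_abs]
      refine intervalIntegral.norm_integral_le_of_norm_le (μ := volume) zero_le_one
        (Eventually.of_forall fun s hs => ?_)
        ((continuous_const.mul (continuous_const.add hcs)).intervalIntegrable 0 1)
      have hqs : |q.eval s| ≤ 1 := by
        have h0 : 0 ≤ s := hs.1.le
        have h1 : 0 ≤ 1 - s := by linarith [hs.2]
        rw [hq]
        simp only [Polynomial.eval_mul, Polynomial.eval_pow, Polynomial.eval_X,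
          Polynomial.eval_sub, Polynomial.eval_one]
        rw [abs_of_nonneg (by positivity)]
        exact mul_le_one₀ (pow_le_one₀ h0 hs.2) (by positivity) (pow_le_one₀ h1 (by linarith))
      rw [Real.norm_eq_abs, abs_mul, hwder _ le_rfl, abs_mul, abs_of_nonneg (by positivity)]
      set a := iteratedDeriv (d + 1) v (T * s)
      have ha : |a| ≤ 1 + a ^ 2 := by
        rw [← sq_abs a]
        nlinarith [sq_nonneg (|a| - 1), abs_nonneg a]
      have hpow : T ^ (d + 1) ≤ T ^ 2 := pow_le_pow_of_le_one hT.le hT1 hk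
      calc T ^ (d + 1) * |a| * |q.eval s| ≤ T ^ 2 * (1 + a ^ 2) * 1 := by gcongr
        _ = _ := mul_one _
    refine hle.trans ?_
    rw [intervalIntegral.integral_const_mul, intervalIntegral.integral_add
      (continuous_const.intervalIntegrable 0 1) (hcs.intervalIntegrable 0 1),
      intervalIntegral.integral_comp_mul_left (fun x => (iteratedDeriv (d + 1) v x) ^ 2) hT.ne']
    simp only [intervalIntegral.integral_const, sub_zero, smul_eq_mul, mul_one, mul_zero]
    have hTT : T ^ 2 ≤ T := by nlinarith
    have : T ^ 2 * (1 + T⁻¹ * ∫ x in (0:ℝ)..T, (iteratedDeriv (d + 1) v x) ^ 2) =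
        T ^ 2 + T * ∫ x in (0:ℝ)..T, (iteratedDeriv (d + 1) v x) ^ 2 := by
      field_simp
    linarith
  have habs : |c| * |v T - v 0| = |(-1) ^ d * (c * (v T - v 0))| := by
    rw [abs_mul ((-1) ^ d), abs_mul c, abs_pow, abs_neg, abs_one, one_pow, one_mul]
  rw [habs, hid]
  have h0 := hB 0 (Or.inl rfl)
  have h1 := hB 1 (Or.inr rfl)
  have htri := abs_add_le ((∫ t in (0:ℝ)..1, iteratedDeriv (d + 1) w t * q.eval t) - B 1) (B 0)
  have htri' := abs_sub (∫ t in (0:ℝ)..1, iteratedDeriv (d + 1) w t * q.eval t) (B 1)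
  linarith

/-- Smooth transitions between two constants, with prescribed increment, flat at the endpoints. -/
theorem exists_contDiff_flat_endpoints (k : ℕ) {T : ℝ} (hT : 0 < T) (z : ℝ) :
    ∃ v : ℝ → ℝ, ContDiff ℝ (k : ℕ∞) v ∧ v T - v 0 = z ∧
      ∀ ℓ : ℕ, 1 ≤ ℓ → iteratedDeriv ℓ v 0 = 0 ∧ iteratedDeriv ℓ v T = 0 := by
  let g : ℝ → ℝ := fun t => 2 * t / T - 1 / 2
  have hg : Continuous g := by fun_prop
  have hg0 : g 0 < 0 := by simp [g]
  have hgT : 1 < g T := by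
    simp only [g]
    rw [mul_div_assoc, div_self hT.ne']
    norm_num
  refine ⟨fun t => z * smoothTransition (g t), ?_, ?_, fun ℓ hℓ => ⟨?_, ?_⟩⟩
  · exact contDiff_const.mul (smoothTransition.contDiff.comp
      (((contDiff_const.mul contDiff_id).div_const T).sub contDiff_const))
  · simp [smoothTransition.zero_of_nonpos hg0.le, smoothTransition.one_of_one_le hgT.le]
  · have h : (fun t => z * smoothTransition (g t)) =ᶠ[𝓝 0] fun _ => 0 := by
      filter_upwards [hg.continuousAt.eventually_lt continuousAt_const hg0] with t ht
      rw [smoothTransition.zero_of_nonpos ht.le, mul_zero]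
    rw [h.iteratedDeriv_eq, iteratedDeriv_const, if_neg (by omega)]
  · have h : (fun t => z * smoothTransition (g t)) =ᶠ[𝓝 T] fun _ => z := by
      filter_upwards [continuousAt_const.eventually_lt hg.continuousAt hgT] with t ht
      rw [smoothTransition.one_of_one_le ht.le, mul_one]
    rw [h.iteratedDeriv_eq, iteratedDeriv_const, if_neg (by omega)]

theorem stmt_5 (k N : ℕ) (hk : 2 ≤ k) (hN : 1 ≤ N) (θ : ℝ) (hθ : 0 < θ)
    (T z : ℕ → ℝ) (hT : ∀ n, 0 < T n) (hT0 : Tendsto T atTop (𝓝 0))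
    (hz : ∀ n, θ ≤ |z n|) :
    Tendsto (fun n => Mfun k N (T n) (z n)) atTop atTop := by
  obtain ⟨c, hc, C, hC⟩ := exists_increment_le k hk
  have hN' : 1 / (N:ℝ) ≤ 1 := by
    rw [div_le_one (by exact_mod_cast hN)]
    exact_mod_cast hN
  have hinv : Tendsto (fun n => c * θ * (T n)⁻¹ - C) atTop atTop := by
    refine tendsto_atTop_add_const_right _ _ (Tendsto.const_mul_atTop (mul_pos hc hθ) ?_)
    exact (tendsto_nhdsWithin_iff.2 ⟨hT0, Eventually.of_forall hT⟩).inv_tendsto_nhdsGT_zero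
  refine tendsto_atTop_mono' _ ?_ hinv
  filter_upwards [hT0.eventually_le_const zero_lt_one] with n hn
  refine le_csInf ?_ ?_
  · obtain ⟨v, hv, hvz, hv0⟩ := exists_contDiff_flat_endpoints k (hT n) (z n)
    refine ⟨_, v, hv, hvz, fun ℓ hℓ _ => ?_, rfl⟩
    rw [(hv0 ℓ hℓ).1, (hv0 ℓ hℓ).2, abs_zero]
    exact ⟨by positivity, by positivity⟩
  · rintro E ⟨v, hv, hvz, hbd, rfl⟩
    have h := hC v (T n) (hT n) hn hv fun ℓ h1 h2 =>
      ⟨(hbd ℓ h1 h2).1.trans hN', (hbd ℓ h1 h2).2.trans hN'⟩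
    rw [hvz] at h
    have h' : c * θ ≤ T n * (C + ∫ t in (0:ℝ)..T n, (iteratedDeriv k v t) ^ 2) := by
      have := mul_le_mul_of_nonneg_left (hz n) hc.le
      linarith
    have h'' := (div_le_iff₀' (hT n)).2 h'
    rw [div_eq_mul_inv] at h''
    linarith
end

section
/- Let k ≥ 3 and N ≥ 1 be integers and let c ∈ (0,1). Then for every z ∈ ℝ with |z| ≤ c³ one has φ_{c,N}(z) ≥ (m(N)/(c·N))·|z|. -/
open Real Filter Topology Set MeasureTheory intervalIntegral

/-- `φ_{c,N}(z)`: infimum of `T + ∫_0^T |v^{(k)}|²` over `T > 0` and `C^k` functions with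
`v(T) - v(0) = z`, `|v'(0)|, |v'(T)| ≤ c`, and `|v^{(ℓ)}(0)|, |v^{(ℓ)}(T)| ≤ 1/N` for
`ℓ ∈ {2,…,ℓ(k)}`, where `ℓ(k) = ⌊k/2⌋`. -/
noncomputable def phiCN (k : ℕ) (c : ℝ) (N : ℕ) (z : ℝ) : ℝ :=
  sInf {E : ℝ | ∃ T : ℝ, 0 < T ∧ ∃ v : ℝ → ℝ, ContDiff ℝ (k : ℕ∞) v ∧
    v T - v 0 = z ∧ |deriv v 0| ≤ c ∧ |deriv v T| ≤ c ∧
    (∀ ℓ : ℕ, 2 ≤ ℓ → ℓ ≤ k / 2 →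
      |iteratedDeriv ℓ v 0| ≤ 1 / (N:ℝ) ∧ |iteratedDeriv ℓ v T| ≤ 1 / (N:ℝ)) ∧
    E = T + ∫ t in (0:ℝ)..T, (iteratedDeriv k v t) ^ 2}

/-- `m(M)`: infimum of `T + ∫_0^T |v^{(k)}|²` over `T > 0` and `C^k` functions with
`v(T) - v(0) = 1` and `|v^{(ℓ)}(0)|, |v^{(ℓ)}(T)| ≤ 1/M` for `ℓ ∈ {1,…,ℓ(k)}`. -/
noncomputable def mconst (k : ℕ) (M : ℝ) : ℝ :=
  sInf {E : ℝ | ∃ T : ℝ, 0 < T ∧ ∃ v : ℝ → ℝ, ContDiff ℝ (k : ℕ∞) v ∧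
    v T - v 0 = 1 ∧
    (∀ ℓ : ℕ, 1 ≤ ℓ → ℓ ≤ k / 2 →
      |iteratedDeriv ℓ v 0| ≤ 1 / M ∧ |iteratedDeriv ℓ v T| ≤ 1 / M) ∧
    E = T + ∫ t in (0:ℝ)..T, (iteratedDeriv k v t) ^ 2}

/-- Rescaling a competitor for `phiCN` with nonzero displacement yields a competitor for `mconst`. -/
lemma mconst_mul_le {k N : ℕ} (hk : 2 ≤ k) (hN : 1 ≤ N) {c z : ℝ} (hc₀ : 0 < c) (hc₁ : c < 1)
    (hz₀ : z ≠ 0) (hz : |z| ≤ c ^ 3) {T : ℝ} (hT : 0 < T) {v : ℝ → ℝ}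
    (hv : ContDiff ℝ (k : ℕ∞) v) (hvz : v T - v 0 = z)
    (h0 : |deriv v 0| ≤ c) (hT' : |deriv v T| ≤ c)
    (hhigh : ∀ ℓ : ℕ, 2 ≤ ℓ → ℓ ≤ k / 2 →
      |iteratedDeriv ℓ v 0| ≤ 1 / (N : ℝ) ∧ |iteratedDeriv ℓ v T| ≤ 1 / (N : ℝ)) :
    (mconst k N / (c * N)) * |z| ≤ T + ∫ t in (0 : ℝ)..T, (iteratedDeriv k v t) ^ 2 := by
  have hN₁ : (1 : ℝ) ≤ N := by exact_mod_cast hN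
  have hN₀ : (0 : ℝ) < N := by linarith
  have hza : 0 < |z| := abs_pos.mpr hz₀
  obtain ⟨r, hr⟩ : ∃ r : ℝ, r = |z| / (c * N) := ⟨_, rfl⟩
  have hr₀ : 0 < r := by rw [hr]; positivity
  have hrz : r * (c * N) = |z| := by rw [hr]; field_simp
  have hc2 : c ^ 2 ≤ c := by nlinarith
  have hrN : r * N ≤ c ^ 2 := by
    have : c * (r * N) ≤ c * c ^ 2 := by nlinarith
    exact le_of_mul_le_mul_left this hc₀
  have hrc : r ≤ c := by nlinarith
  have hr₁ : r ≤ 1 := by linarith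
  have hrpow : ∀ ℓ : ℕ, 2 ≤ ℓ → r ^ ℓ ≤ |z| := by
    intro ℓ hℓ
    calc r ^ ℓ ≤ r ^ 2 := pow_le_pow_of_le_one hr₀.le hr₁ hℓ
      _ = r * r := sq r
      _ ≤ r * (c * N) := by gcongr; nlinarith
      _ = |z| := hrz
  have hd : ∀ ℓ : ℕ, ℓ ≤ k → ∀ s : ℝ,
      iteratedDeriv ℓ (fun s => z⁻¹ * v (r * s)) s = z⁻¹ * (r ^ ℓ * iteratedDeriv ℓ v (r * s)) := by
    intro ℓ hℓ s
    have hvℓ : ContDiff ℝ ℓ v := hv.of_le (by exact_mod_cast hℓ)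
    rw [iteratedDeriv_const_mul_field, iteratedDeriv_comp_const_mul hvℓ]
  have hrT : r * (T / r) = T := by field_simp
  have hbound : ∀ ℓ : ℕ, 1 ≤ ℓ → ∀ x : ℝ, (ℓ = 1 → |x| ≤ c) → (2 ≤ ℓ → |x| ≤ 1 / (N : ℝ)) →
      |z⁻¹ * (r ^ ℓ * x)| ≤ 1 / (N : ℝ) := by
    intro ℓ hℓ x hx₁ hx₂
    rw [abs_mul, abs_mul, abs_inv, abs_of_pos (pow_pos hr₀ ℓ), inv_mul_le_iff₀ hza]
    rcases hℓ.eq_or_lt with rfl | hℓ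
    · calc r ^ 1 * |x| ≤ r ^ 1 * c := by gcongr; exact hx₁ rfl
        _ = |z| * (1 / N) := by rw [← hrz]; field_simp
    · exact mul_le_mul (hrpow ℓ hℓ) (hx₂ hℓ) (abs_nonneg _) hza.le
  have hint : 0 ≤ ∫ t in (0 : ℝ)..T, (iteratedDeriv k v t) ^ 2 :=
    intervalIntegral.integral_nonneg hT.le fun _ _ => sq_nonneg _
  have hder : ∀ ℓ : ℕ, 1 ≤ ℓ → ℓ ≤ k / 2 →
      |iteratedDeriv ℓ (fun s => z⁻¹ * v (r * s)) 0| ≤ 1 / (N : ℝ) ∧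
        |iteratedDeriv ℓ (fun s => z⁻¹ * v (r * s)) (T / r)| ≤ 1 / (N : ℝ) := by
    intro ℓ h₁ h₂
    rw [hd ℓ (by omega), hd ℓ (by omega), mul_zero, hrT]
    constructor
    · refine hbound ℓ h₁ _ ?_ fun h => (hhigh ℓ h h₂).1
      rintro rfl
      rwa [iteratedDeriv_one]
    · refine hbound ℓ h₁ _ ?_ fun h => (hhigh ℓ h h₂).2
      rintro rfl
      rwa [iteratedDeriv_one]
  have hm : mconst k N ≤
      T / r + ∫ t in (0 : ℝ)..(T / r), (iteratedDeriv k (fun s => z⁻¹ * v (r * s)) t) ^ 2 := by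
    refine csInf_le ⟨0, ?_⟩ ⟨T / r, div_pos hT hr₀, fun s => z⁻¹ * v (r * s), ?_, ?_, hder, rfl⟩
    · rintro E ⟨S, hS, w, -, -, -, rfl⟩
      exact add_nonneg hS.le (intervalIntegral.integral_nonneg hS.le fun _ _ => sq_nonneg _)
    · exact contDiff_const.mul (hv.comp (contDiff_const.mul contDiff_id))
    · simp only [hrT, mul_zero]
      rw [← mul_sub, hvz, inv_mul_cancel₀ hz₀]
  have henergy : r * ∫ t in (0 : ℝ)..(T / r), (iteratedDeriv k (fun s => z⁻¹ * v (r * s)) t) ^ 2 =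
      (z⁻¹ * r ^ k) ^ 2 * ∫ t in (0 : ℝ)..T, (iteratedDeriv k v t) ^ 2 := by
    have hcongr : ∀ t : ℝ, (iteratedDeriv k (fun s => z⁻¹ * v (r * s)) t) ^ 2 =
        (z⁻¹ * r ^ k) ^ 2 * (iteratedDeriv k v (r * t)) ^ 2 := by
      intro t
      rw [hd k le_rfl]
      ring
    simp only [hcongr]
    rw [intervalIntegral.integral_const_mul, mul_left_comm,
      intervalIntegral.mul_integral_comp_mul_left (f := fun t => (iteratedDeriv k v t) ^ 2),
      mul_zero, hrT]
  have hfactor : (z⁻¹ * r ^ k) ^ 2 ≤ 1 := by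
    rw [sq_le_one_iff_abs_le_one, abs_mul, abs_inv, abs_of_pos (pow_pos hr₀ k),
      inv_mul_le_iff₀ hza, mul_one]
    exact hrpow k hk
  calc (mconst k N / (c * N)) * |z| = r * mconst k N := by rw [hr]; ring
    _ ≤ r * (T / r + ∫ t in (0 : ℝ)..(T / r),
          (iteratedDeriv k (fun s => z⁻¹ * v (r * s)) t) ^ 2) := by gcongr
    _ = T + (z⁻¹ * r ^ k) ^ 2 * ∫ t in (0 : ℝ)..T, (iteratedDeriv k v t) ^ 2 := by
        rw [mul_add, hrT, henergy]
    _ ≤ T + ∫ t in (0 : ℝ)..T, (iteratedDeriv k v t) ^ 2 := by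
        gcongr
        exact mul_le_of_le_one_left hint hfactor

theorem stmt_6 (k N : ℕ) (hk : 3 ≤ k) (hN : 1 ≤ N) (c : ℝ) (hc : c ∈ Set.Ioo (0:ℝ) 1)
    (z : ℝ) (hz : |z| ≤ c ^ 3) :
    (mconst k N / (c * N)) * |z| ≤ phiCN k c N z := by
  obtain ⟨hc₀, hc₁⟩ := hc
  have hzc : |z| ≤ c := hz.trans (pow_le_of_le_one hc₀.le hc₁.le three_ne_zero)
  refine le_csInf ?_ ?_
  · have hderiv : deriv (fun t : ℝ => z * t) = fun _ => z := by
      ext t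
      simp
    refine ⟨_, 1, one_pos, fun t => z * t, contDiff_const.mul contDiff_id, by simp, ?_, ?_, ?_, rfl⟩
    · rwa [hderiv]
    · rwa [hderiv]
    · intro ℓ hℓ _
      obtain ⟨j, rfl⟩ := Nat.exists_eq_add_of_le' hℓ
      have hzero : iteratedDeriv (j + 2) (fun t : ℝ => z * t) = fun _ => 0 := by
        rw [iteratedDeriv_succ', hderiv]
        ext t
        simp [iteratedDeriv_const]
      simp [hzero]
  · rintro E ⟨T, hT, v, hv, hvz, h0, hT', hhigh, rfl⟩
    rcases eq_or_ne z 0 with hz₀ | hz₀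
    · rw [hz₀, abs_zero, mul_zero]
      exact add_nonneg hT.le (intervalIntegral.integral_nonneg hT.le fun _ _ => sq_nonneg _)
    · exact mconst_mul_le (by omega) hN hc₀ hc₁ hz₀ hz hT hv hvz h0 hT' hhigh
end

section
/- Let k ≥ 2 and N ≥ 1 be integers and let θ ∈ (0,1). Then there exists δ > 0 (depending on k, N, θ) such that for every c ∈ (0,δ) and every z ∈ ℝ with |z| ≥ θ one has φ_{c,N}(z) ≥ m(θ·N)·|z|^{1/k}. -/
open Real Filter Topology Set MeasureTheory intervalIntegral

/-- The admissible energies in the definition of `phiCN` are non-empty for `c > 0`, `z ≠ 0`: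
an affine function of slope `±c` is a competitor. -/
theorem phiCN_set_nonempty (k N : ℕ) {c z : ℝ} (hc : 0 < c) (hz : z ≠ 0) :
    {E : ℝ | ∃ T : ℝ, 0 < T ∧ ∃ v : ℝ → ℝ, ContDiff ℝ (k : ℕ∞) v ∧
      v T - v 0 = z ∧ |deriv v 0| ≤ c ∧ |deriv v T| ≤ c ∧
      (∀ ℓ : ℕ, 2 ≤ ℓ → ℓ ≤ k / 2 →
        |iteratedDeriv ℓ v 0| ≤ 1 / (N:ℝ) ∧ |iteratedDeriv ℓ v T| ≤ 1 / (N:ℝ)) ∧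
      E = T + ∫ t in (0:ℝ)..T, (iteratedDeriv k v t) ^ 2}.Nonempty := by
  have hz' : 0 < |z| := abs_pos.mpr hz
  have hderiv : deriv (fun t : ℝ => c * z / |z| * t) = fun _ => c * z / |z| := by
    funext t
    simpa only [id, mul_one] using ((hasDerivAt_id t).const_mul (c * z / |z|)).deriv
  have habs : |(c * z / |z|)| = c := by
    rw [abs_div, abs_mul, abs_abs, abs_of_pos hc, mul_div_assoc, div_self hz'.ne', mul_one]
  have hzero : ∀ ℓ : ℕ, 2 ≤ ℓ → ∀ t, iteratedDeriv ℓ (fun t : ℝ => c * z / |z| * t) t = 0 := by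
    intro ℓ hℓ t
    obtain ⟨n, rfl⟩ : ∃ n, ℓ = n + 1 + 1 := ⟨ℓ - 2, by omega⟩
    rw [iteratedDeriv_succ', hderiv, iteratedDeriv_const]
    simp
  refine ⟨_, |z| / c, by positivity, fun t => c * z / |z| * t, by fun_prop, ?_, ?_, ?_, ?_, rfl⟩
  · field_simp
    ring
  · rw [hderiv, habs]
  · rw [hderiv, habs]
  · intro ℓ h2 _
    rw [hzero ℓ h2, hzero ℓ h2, abs_zero]
    exact ⟨by positivity, by positivity⟩

/-- The iterated derivatives of the rescaling `t ↦ v (r t) / z`. -/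
theorem iteratedDeriv_rescale {k n : ℕ} (hn : n ≤ k) {v : ℝ → ℝ} (hv : ContDiff ℝ (k : ℕ∞) v)
    (r z t : ℝ) :
    iteratedDeriv n (fun s => z⁻¹ * v (r * s)) t = z⁻¹ * (r ^ n * iteratedDeriv n v (r * t)) := by
  have hvn : ContDiff ℝ n v := hv.of_le (by exact_mod_cast hn)
  rw [iteratedDeriv_const_mul_field, iteratedDeriv_comp_const_mul hvn]

/-- If `r ^ k = |z|` with `|z| ≥ θ` and `2n ≤ k`, then rescaling by `r` multiplies the `n`-th
derivative by a factor at most `1 / θ`. -/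
theorem rescale_factor_le {k n : ℕ} (hn : n ≤ k) {r z θ : ℝ} (hr : 0 < r) (hz : r ^ k = |z|)
    (hθ : 0 < θ) (hθ1 : θ < 1) (hzθ : θ ≤ |z|) : |z|⁻¹ * r ^ n ≤ θ⁻¹ := by
  have hz0 : 0 < |z| := hθ.trans_le hzθ
  rcases le_total r 1 with h | h
  · calc |z|⁻¹ * r ^ n ≤ |z|⁻¹ * 1 := by
          gcongr
          exact pow_le_one₀ hr.le h
      _ = |z|⁻¹ := mul_one _
      _ ≤ θ⁻¹ := by gcongr
  · calc |z|⁻¹ * r ^ n ≤ |z|⁻¹ * r ^ k := by gcongr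
      _ = 1 := by rw [hz, inv_mul_cancel₀ hz0.ne']
      _ ≤ θ⁻¹ := (one_le_inv₀ hθ).mpr hθ1.le

theorem bddBelow_mconst_set (k : ℕ) (M : ℝ) :
    BddBelow {E : ℝ | ∃ T : ℝ, 0 < T ∧ ∃ v : ℝ → ℝ, ContDiff ℝ (k : ℕ∞) v ∧
      v T - v 0 = 1 ∧
      (∀ ℓ : ℕ, 1 ≤ ℓ → ℓ ≤ k / 2 →
        |iteratedDeriv ℓ v 0| ≤ 1 / M ∧ |iteratedDeriv ℓ v T| ≤ 1 / M) ∧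
      E = T + ∫ t in (0:ℝ)..T, (iteratedDeriv k v t) ^ 2} := by
  refine ⟨0, ?_⟩
  rintro E ⟨T, hT, v, -, -, -, rfl⟩
  have := intervalIntegral.integral_nonneg (μ := volume) hT.le
    (fun t _ => sq_nonneg (iteratedDeriv k v t))
  linarith

theorem stmt_8 (k N : ℕ) (hk : 2 ≤ k) (hN : 1 ≤ N) (θ : ℝ) (hθ : θ ∈ Set.Ioo (0:ℝ) 1) :
    ∃ δ : ℝ, 0 < δ ∧ ∀ c ∈ Set.Ioo (0:ℝ) δ, ∀ z : ℝ, θ ≤ |z| →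
      mconst k (θ * N) * |z| ^ ((1:ℝ)/(k:ℝ)) ≤ phiCN k c N z := by
  obtain ⟨hθ0, hθ1⟩ := hθ
  have hN0 : (0:ℝ) < N := by exact_mod_cast hN
  refine ⟨1 / N, by positivity, ?_⟩
  rintro c ⟨hc0, hcδ⟩ z hzθ
  have hz0 : 0 < |z| := hθ0.trans_le hzθ
  have hz : z ≠ 0 := abs_pos.mp hz0
  refine le_csInf (phiCN_set_nonempty k N hc0 hz) ?_
  rintro E ⟨T, hT, v, hv, hvz, hd0, hdT, hd, rfl⟩
  set r : ℝ := |z| ^ ((1:ℝ)/(k:ℝ)) with hr_def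
  have hr : 0 < r := Real.rpow_pos_of_pos hz0 _
  have hrk : r ^ k = |z| := by
    rw [hr_def, one_div]
    exact Real.rpow_inv_natCast_pow hz0.le (by omega)
  have hrT : r * (T / r) = T := by field_simp
  have hbound : ∀ ℓ : ℕ, 1 ≤ ℓ → ℓ ≤ k / 2 →
      |iteratedDeriv ℓ v 0| ≤ 1 / (N:ℝ) ∧ |iteratedDeriv ℓ v T| ≤ 1 / (N:ℝ) := by
    intro ℓ h1 h2
    rcases h1.eq_or_lt with rfl | h
    · rw [iteratedDeriv_one]
      exact ⟨hd0.trans hcδ.le, hdT.trans hcδ.le⟩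
    · exact hd ℓ h h2
  have hscale : ∀ ℓ : ℕ, ℓ ≤ k / 2 → ∀ x : ℝ, |x| ≤ 1 / (N:ℝ) →
      |z⁻¹ * (r ^ ℓ * x)| ≤ 1 / (θ * N) := by
    intro ℓ hℓ x hx
    have hfac := rescale_factor_le (n := ℓ) (by omega) hr hrk hθ0 hθ1 hzθ
    calc |z⁻¹ * (r ^ ℓ * x)| = |z|⁻¹ * r ^ ℓ * |x| := by
          rw [abs_mul, abs_mul, abs_inv, abs_of_pos (pow_pos hr ℓ), mul_assoc]
      _ ≤ θ⁻¹ * (1 / N) := by gcongr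
      _ = 1 / (θ * N) := by field_simp
  have hle : mconst k (θ * N) ≤ (T + ∫ t in (0:ℝ)..T, (iteratedDeriv k v t) ^ 2) / r := by
    refine csInf_le (bddBelow_mconst_set k _)
      ⟨T / r, by positivity, fun s => z⁻¹ * v (r * s), by fun_prop, ?_, ?_, ?_⟩
    · simp only [hrT, mul_zero]
      rw [← mul_sub, hvz, inv_mul_cancel₀ hz]
    · intro ℓ h1 h2
      rw [iteratedDeriv_rescale (by omega) hv, iteratedDeriv_rescale (by omega) hv, hrT, mul_zero]
      exact ⟨hscale ℓ h2 _ (hbound ℓ h1 h2).1, hscale ℓ h2 _ (hbound ℓ h1 h2).2⟩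
    · have hcoef : z⁻¹ ^ 2 * (r ^ k) ^ 2 = 1 := by
        rw [hrk, sq_abs, ← mul_pow, inv_mul_cancel₀ hz, one_pow]
      have hint : ∀ t, (iteratedDeriv k (fun s => z⁻¹ * v (r * s)) t) ^ 2
          = (iteratedDeriv k v (r * t)) ^ 2 := by
        intro t
        rw [iteratedDeriv_rescale le_rfl hv, mul_pow, mul_pow, ← mul_assoc, hcoef, one_mul]
      simp only [hint]
      rw [intervalIntegral.integral_comp_mul_left (fun t => (iteratedDeriv k v t) ^ 2) hr.ne',
        hrT, mul_zero, smul_eq_mul]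
      ring
  exact (le_div_iff₀ hr).mp hle
end

section
/- Let k ≥ 2 be an integer. For every z ∈ ℝ the sequence N ↦ φ_N(z) is nondecreasing, φ_N(z) ≤ m_k·|z|^{1/k} for all N, and φ_N(z) → m_k·|z|^{1/k} as N → ∞. Moreover, the convergence is uniform on every compact subset of ℝ \ {0}: for every compact set K ⊂ ℝ with 0 ∉ K, sup_{z ∈ K} |φ_N(z) − m_k·|z|^{1/k}| → 0 as N → ∞. -/
open Real Filter Topology Set MeasureTheory intervalIntegral

/-- `φ_N(z)`: infimum of `T + ∫_0^T |v^{(k)}|²` over `T > 0` and `C^k` functions with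
`v(T) - v(0) = z` and `|v^{(ℓ)}(0)|, |v^{(ℓ)}(T)| ≤ 1/N` for all `ℓ ∈ {1,…,k-1}`. -/
noncomputable def phiN (k N : ℕ) (z : ℝ) : ℝ :=
  sInf {E : ℝ | ∃ T : ℝ, 0 < T ∧ ∃ v : ℝ → ℝ, ContDiff ℝ (k : ℕ∞) v ∧
    v T - v 0 = z ∧
    (∀ ℓ : ℕ, 1 ≤ ℓ → ℓ ≤ k - 1 →
      |iteratedDeriv ℓ v 0| ≤ 1 / (N:ℝ) ∧ |iteratedDeriv ℓ v T| ≤ 1 / (N:ℝ)) ∧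
    E = T + ∫ t in (0:ℝ)..T, (iteratedDeriv k v t) ^ 2}

/-- `m_k`: infimum of `T + ∫_0^T |v^{(k)}|²` over `T > 0` and `C^k` functions with
`v(0) = 0`, `v(T) = 1`, and `v^{(ℓ)}(0) = v^{(ℓ)}(T) = 0` for all `ℓ ∈ {1,…,k-1}`. -/
noncomputable def mkConst (k : ℕ) : ℝ :=
  sInf {E : ℝ | ∃ T : ℝ, 0 < T ∧ ∃ v : ℝ → ℝ, ContDiff ℝ (k : ℕ∞) v ∧
    v 0 = 0 ∧ v T = 1 ∧
    (∀ ℓ : ℕ, 1 ≤ ℓ → ℓ ≤ k - 1 →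
      iteratedDeriv ℓ v 0 = 0 ∧ iteratedDeriv ℓ v T = 0) ∧
    E = T + ∫ t in (0:ℝ)..T, (iteratedDeriv k v t) ^ 2}

/-- The derivatives of `v` of orders `1, …, k - 1` are at most `ε` in absolute value
at both ends of `[0, T]`. -/
def EndpointBound (k : ℕ) (ε T : ℝ) (v : ℝ → ℝ) : Prop :=
  ∀ ℓ : ℕ, 1 ≤ ℓ → ℓ ≤ k - 1 → |iteratedDeriv ℓ v 0| ≤ ε ∧ |iteratedDeriv ℓ v T| ≤ ε

/-- The energy `T + ∫_0^T |v^{(k)}|²`. -/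
noncomputable def transitionEnergy (k : ℕ) (T : ℝ) (v : ℝ → ℝ) : ℝ :=
  T + ∫ t in (0:ℝ)..T, (iteratedDeriv k v t) ^ 2

theorem integral_sq_nonneg {T : ℝ} (hT : 0 < T) (f : ℝ → ℝ) :
    0 ≤ ∫ t in (0:ℝ)..T, f t ^ 2 :=
  integral_nonneg hT.le fun _ _ => sq_nonneg _

theorem transitionEnergy_nonneg {k : ℕ} {T : ℝ} (hT : 0 < T) (v : ℝ → ℝ) :
    0 ≤ transitionEnergy k T v :=
  add_nonneg hT.le (integral_sq_nonneg hT _)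

theorem EndpointBound.mono {k : ℕ} {ε ε' T : ℝ} {v : ℝ → ℝ} (h : EndpointBound k ε T v)
    (hε : ε ≤ ε') : EndpointBound k ε' T v :=
  fun ℓ h1 h2 => ⟨(h ℓ h1 h2).1.trans hε, (h ℓ h1 h2).2.trans hε⟩

theorem phiN_le {k N : ℕ} {T : ℝ} {v : ℝ → ℝ} (hT : 0 < T) (hv : ContDiff ℝ k v)
    (hb : EndpointBound k (1 / N) T v) : phiN k N (v T - v 0) ≤ transitionEnergy k T v := by
  refine csInf_le ⟨0, ?_⟩ ⟨T, hT, v, mod_cast hv, rfl, hb, rfl⟩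
  rintro _ ⟨T, hT, v, -, -, -, rfl⟩
  exact transitionEnergy_nonneg hT v

theorem mkConst_le {k : ℕ} {T : ℝ} {v : ℝ → ℝ} (hT : 0 < T) (hv : ContDiff ℝ k v)
    (hb : EndpointBound k 0 T v) (h0 : v 0 = 0) (h1 : v T = 1) :
    mkConst k ≤ transitionEnergy k T v := by
  refine csInf_le ⟨0, ?_⟩ ⟨T, hT, v, mod_cast hv, h0, h1, fun ℓ h h' => ?_, rfl⟩
  · rintro _ ⟨T, hT, v, -, -, -, -, rfl⟩
    exact transitionEnergy_nonneg hT v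
  · simpa using hb ℓ h h'

theorem phiN_nonneg (k N : ℕ) (z : ℝ) : 0 ≤ phiN k N z := by
  refine Real.sInf_nonneg ?_
  rintro _ ⟨T, hT, v, -, -, -, rfl⟩
  exact transitionEnergy_nonneg hT v

theorem mkConst_nonneg (k : ℕ) : 0 ≤ mkConst k := by
  refine Real.sInf_nonneg ?_
  rintro _ ⟨T, hT, v, -, -, -, -, rfl⟩
  exact transitionEnergy_nonneg hT v

/-- Smooth functions vanishing to the right of `τ` whose only nonzero derivative at `0` is the
one of order `ℓ`. -/
theorem exists_contDiff_iteratedDeriv_zero_eq (ℓ : ℕ) {τ : ℝ} (hτ : 0 < τ) :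
    ∃ f : ℝ → ℝ, (∀ n : ℕ, ContDiff ℝ n f) ∧
      (∀ j, iteratedDeriv j f 0 = if j = ℓ then 1 else 0) ∧
      ∀ j, ∀ t, τ ≤ t → iteratedDeriv j f t = 0 := by
  set χ : ℝ → ℝ := fun t => smoothTransition ((τ / 2 - t) * (4 / τ)) with hχ
  refine ⟨fun t => (χ t * t ^ ℓ) / (ℓ.factorial : ℝ), fun n => ?_, fun j => ?_,
    fun j t ht => ?_⟩
  · have : ContDiff ℝ n χ := by
      have := Real.smoothTransition.contDiff (n := n)
      exact ContDiff.comp (g := smoothTransition) (f := fun t => (τ / 2 - t) * (4 / τ))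
        (mod_cast this) (by fun_prop)
    fun_prop
  · have hev : (fun t => (χ t * t ^ ℓ) / (ℓ.factorial : ℝ)) =ᶠ[𝓝 0]
        fun t => t ^ ℓ / (ℓ.factorial : ℝ) := by
      filter_upwards [Iio_mem_nhds (show (0:ℝ) < τ / 4 by positivity)] with t ht
      have ht : t < τ / 4 := ht
      have : χ t = 1 := by
        apply Real.smoothTransition.one_of_one_le
        calc (1:ℝ) = (τ / 4) * (4 / τ) := by field_simp
          _ ≤ _ := by gcongr; linarith
      simp [this]
    rw [hev.iteratedDeriv_eq, iteratedDeriv_div_const, iteratedDeriv_fun_pow_zero]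
    have := Nat.factorial_ne_zero ℓ
    split_ifs with h
    · field_simp
    · simp
  · have hev : (fun t => (χ t * t ^ ℓ) / (ℓ.factorial : ℝ)) =ᶠ[𝓝 t] fun _ => 0 := by
      filter_upwards [Ioi_mem_nhds (show τ / 2 < t by linarith)] with s hs
      have hs : τ / 2 < s := hs
      have : χ s = 0 := by
        apply Real.smoothTransition.zero_of_nonpos
        exact mul_nonpos_of_nonpos_of_nonneg (by linarith) (by positivity)
      simp [this]
    rw [hev.iteratedDeriv_eq, iteratedDeriv_fun_const_zero]

/-- Scaling amplitude and time by `a` and `c`, and subtracting the initial value. -/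
theorem exists_rescaled {k : ℕ} {T ε : ℝ} {v : ℝ → ℝ} (hk : 1 ≤ k) (hv : ContDiff ℝ k v)
    (hb : EndpointBound k 0 T v) {a c : ℝ} (hc : 0 < c) (hac : |a| = c ^ k) (hε : 0 ≤ ε) :
    ∃ w : ℝ → ℝ, ContDiff ℝ k w ∧ EndpointBound k ε (c * T) w ∧ w 0 = 0 ∧
      w (c * T) = a * (v T - v 0) ∧
      transitionEnergy k (c * T) w = c * transitionEnergy k T v := by
  have hder : ∀ ℓ, 1 ≤ ℓ → ℓ ≤ k → ∀ t,
      iteratedDeriv ℓ (fun t => -(a * v 0) + a * v (c⁻¹ * t)) t =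
        a * (c⁻¹ ^ ℓ * iteratedDeriv ℓ v (c⁻¹ * t)) := by
    intro ℓ h1 h2 t
    rw [iteratedDeriv_const_add h1, iteratedDeriv_const_mul_field,
      iteratedDeriv_comp_const_mul (hv.of_le (mod_cast h2))]
  have hcT : c⁻¹ * (c * T) = T := by field_simp
  refine ⟨fun t => -(a * v 0) + a * v (c⁻¹ * t), by fun_prop, fun ℓ h1 h2 => ?_, by simp, ?_, ?_⟩
  · have := hb ℓ h1 h2
    simp only [abs_nonpos_iff] at this
    rw [hder ℓ h1 (by omega), hder ℓ h1 (by omega), hcT, mul_zero, this.1, this.2]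
    simpa using hε
  · simp only [hcT]; ring
  · unfold transitionEnergy
    have h2 : ∀ t, iteratedDeriv k (fun t => -(a * v 0) + a * v (c⁻¹ * t)) t ^ 2 =
        iteratedDeriv k v (c⁻¹ * t) ^ 2 := by
      intro t
      have ha : a ^ 2 = (c ^ k) ^ 2 := by rw [← hac, sq_abs]
      rw [hder k hk le_rfl, mul_pow, mul_pow, ha, inv_pow]
      field_simp
    simp only [h2]
    rw [intervalIntegral.integral_comp_mul_left (fun t => iteratedDeriv k v t ^ 2)
      (inv_ne_zero hc.ne'), hcT]
    simp [mul_add]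

theorem mkConst_mul_rpow_le {k : ℕ} (hk : 1 ≤ k) {T : ℝ} {v : ℝ → ℝ} (hT : 0 < T)
    (hv : ContDiff ℝ k v) (hb : EndpointBound k 0 T v) (hz : v T - v 0 ≠ 0) :
    mkConst k * |v T - v 0| ^ ((1:ℝ) / k) ≤ transitionEnergy k T v := by
  set z := v T - v 0
  have hz' : 0 < |z| := abs_pos.2 hz
  have hpos : 0 < |z| ^ ((1:ℝ) / k) := Real.rpow_pos_of_pos hz' _
  obtain ⟨w, hw, hwb, hw0, hw1, hE⟩ := exists_rescaled hk hv hb (a := z⁻¹) (ε := 0)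
    (inv_pos.2 hpos) (by
      rw [abs_inv, inv_pow, one_div, Real.rpow_inv_natCast_pow hz'.le (by omega)]) le_rfl
  have := mkConst_le (by positivity) hw hwb hw0 (by rw [hw1]; exact inv_mul_cancel₀ hz)
  rw [hE, inv_mul_eq_div, le_div_iff₀ hpos] at this
  exact this

theorem exists_clamped_energy_lt {k : ℕ} {c : ℝ} (hc : mkConst k < c) :
    ∃ T : ℝ, 0 < T ∧ ∃ v : ℝ → ℝ, ContDiff ℝ k v ∧ EndpointBound k 0 T v ∧
      v T - v 0 = 1 ∧ transitionEnergy k T v < c := by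
  obtain ⟨_, ⟨T, hT, v, hv, h0, h1, hb, rfl⟩, hlt⟩ := exists_lt_of_csInf_lt (by
    obtain ⟨f, hf, hf0, hf1⟩ := exists_contDiff_iteratedDeriv_zero_eq 0 one_pos
    refine ⟨_, 1, one_pos, fun t => 1 - f t, ?_, ?_, ?_, fun ℓ h1 h2 => ⟨?_, ?_⟩, rfl⟩
    · exact contDiff_const.sub (mod_cast hf k)
    · simpa [sub_eq_zero] using (hf0 0).symm
    · simpa using hf1 0 1 le_rfl
    · rw [iteratedDeriv_const_sub h1, iteratedDeriv_neg, hf0, if_neg (by omega), neg_zero]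
    · rw [iteratedDeriv_const_sub h1, iteratedDeriv_neg, hf1 _ _ le_rfl, neg_zero]) hc
  exact ⟨T, hT, v, mod_cast hv, fun ℓ h h' => by simpa using hb ℓ h h', by simp [h0, h1], hlt⟩

theorem exists_clamped_energy_lt_mul_rpow {k : ℕ} (hk : 1 ≤ k) {z c ε : ℝ} (hz : z ≠ 0)
    (hε : 0 ≤ ε) (hc : mkConst k * |z| ^ ((1:ℝ) / k) < c) :
    ∃ T : ℝ, 0 < T ∧ ∃ v : ℝ → ℝ, ContDiff ℝ k v ∧ EndpointBound k ε T v ∧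
      v T - v 0 = z ∧ transitionEnergy k T v < c := by
  have hz' : 0 < |z| := abs_pos.2 hz
  have hpos : 0 < |z| ^ ((1:ℝ) / k) := Real.rpow_pos_of_pos hz' _
  rw [← lt_div_iff₀ hpos] at hc
  obtain ⟨T, hT, v, hv, hb, h1, hlt⟩ := exists_clamped_energy_lt hc
  obtain ⟨w, hw, hwb, hw0, hw1, hE⟩ := exists_rescaled hk hv hb (a := z) (ε := ε)
    hpos (by rw [one_div, Real.rpow_inv_natCast_pow hz'.le (by omega)]) hε
  refine ⟨_, by positivity, w, hw, hwb, by rw [hw0, hw1, h1]; ring, ?_⟩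
  rw [lt_div_iff₀ hpos] at hlt
  rw [hE]
  linarith

theorem phiN_zero {k : ℕ} (N : ℕ) : phiN k N 0 = 0 := by
  refine le_antisymm (le_of_forall_pos_le_add fun ε hε => ?_) (phiN_nonneg _ _ _)
  have h : ∀ ℓ (t : ℝ), iteratedDeriv ℓ (fun _ : ℝ => (0:ℝ)) t = 0 :=
    fun ℓ t => iteratedDeriv_fun_const_zero
  simpa [transitionEnergy, h] using phiN_le (k := k) (N := N) (v := fun _ => (0:ℝ)) hε
    contDiff_const (fun ℓ _ _ => by simp [h])

theorem phiN_le_mkConst_mul {k : ℕ} (hk : 1 ≤ k) (N : ℕ) (z : ℝ) :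
    phiN k N z ≤ mkConst k * |z| ^ ((1:ℝ) / k) := by
  rcases eq_or_ne z 0 with rfl | hz
  · rw [phiN_zero]
    have := mkConst_nonneg k
    positivity
  · refine le_of_forall_gt fun c hc => ?_
    obtain ⟨T, hT, v, hv, hb, rfl, hlt⟩ :=
      exists_clamped_energy_lt_mul_rpow hk hz (by positivity : (0:ℝ) ≤ 1 / N) hc
    exact (phiN_le hT hv hb).trans_lt hlt

theorem exists_energy_lt_of_phiN_lt {k : ℕ} (hk : 1 ≤ k) {N : ℕ} {z c : ℝ} (hz : z ≠ 0)
    (hc : phiN k N z < c) :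
    ∃ T : ℝ, 0 < T ∧ ∃ v : ℝ → ℝ, ContDiff ℝ k v ∧ EndpointBound k (1 / N) T v ∧
      v T - v 0 = z ∧ transitionEnergy k T v < c := by
  obtain ⟨_, ⟨T, hT, v, hv, h1, hb, rfl⟩, hlt⟩ := exists_lt_of_csInf_lt (by
    obtain ⟨T, hT, v, hv, hb, h, -⟩ := exists_clamped_energy_lt_mul_rpow hk hz
      (by positivity : (0:ℝ) ≤ 1 / N) (lt_add_one _)
    exact ⟨_, T, hT, v, mod_cast hv, h, hb, rfl⟩) hc
  exact ⟨T, hT, v, mod_cast hv, hb, h1, hlt⟩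

theorem phiN_mono {k : ℕ} (hk : 1 ≤ k) (z : ℝ) {N M : ℕ} (hN : 1 ≤ N) (hNM : N ≤ M) :
    phiN k N z ≤ phiN k M z := by
  rcases eq_or_ne z 0 with rfl | hz
  · simp [phiN_zero]
  · refine le_of_forall_gt fun c hc => ?_
    obtain ⟨T, hT, v, hv, hb, rfl, hlt⟩ := exists_energy_lt_of_phiN_lt hk hz hc
    exact (phiN_le hT hv (hb.mono (by gcongr))).trans_lt hlt

/-- Correcting the derivatives at the ends of an interval of length at least `τ`. -/
theorem exists_clamped_near (k : ℕ) {τ : ℝ} (hτ : 0 < τ) :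
    ∃ C : ℝ, 0 ≤ C ∧ ∀ ε T : ℝ, τ ≤ T → ∀ v : ℝ → ℝ, ContDiff ℝ k v →
      EndpointBound k ε T v → ∃ w : ℝ → ℝ, ContDiff ℝ k w ∧ EndpointBound k 0 T w ∧
        w T - w 0 = v T - v 0 ∧
        ∀ t ∈ Icc 0 T, |iteratedDeriv k v t - iteratedDeriv k w t| ≤ ε * C := by
  choose f hf hf0 hf1 using fun ℓ => exists_contDiff_iteratedDeriv_zero_eq ℓ hτ
  have hbd : ∀ ℓ, ∃ C, 0 ≤ C ∧ ∀ t, 0 ≤ t → |iteratedDeriv k (f ℓ) t| ≤ C := by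
    intro ℓ
    obtain ⟨C, hC⟩ := (isCompact_Icc (a := (0:ℝ)) (b := τ)).exists_bound_of_continuousOn
      ((hf ℓ k).continuous_iteratedDeriv' k).continuousOn
    refine ⟨|C|, abs_nonneg _, fun t ht => ?_⟩
    rcases le_total t τ with h | h
    · exact (hC t ⟨ht, h⟩).trans (le_abs_self C)
    · simp [hf1 ℓ k t h]
  choose C hC0 hC using hbd
  refine ⟨∑ ℓ ∈ Finset.Icc 1 (k - 1), 2 * C ℓ,
    Finset.sum_nonneg fun ℓ _ => mul_nonneg zero_le_two (hC0 ℓ), fun ε T hT v hv hb => ?_⟩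
  set p : ℝ → ℝ := fun t => ∑ ℓ ∈ Finset.Icc 1 (k - 1),
    (iteratedDeriv ℓ v 0 * f ℓ t + (-1) ^ ℓ * iteratedDeriv ℓ v T * f ℓ (T - t)) with hp
  have hpd : ∀ j t, iteratedDeriv j p t = ∑ ℓ ∈ Finset.Icc 1 (k - 1),
      (iteratedDeriv ℓ v 0 * iteratedDeriv j (f ℓ) t +
        (-1) ^ ℓ * iteratedDeriv ℓ v T * ((-1) ^ j * iteratedDeriv j (f ℓ) (T - t))) := by
    intro j t
    have h1 : ∀ ℓ, ContDiff ℝ j (f ℓ) := fun ℓ => hf ℓ j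
    have h2 : ∀ ℓ, ContDiff ℝ j (fun t => f ℓ (T - t)) :=
      fun ℓ => (h1 ℓ).comp (by fun_prop)
    rw [hp, iteratedDeriv_fun_sum fun ℓ _ => ContDiff.contDiffAt
      ((contDiff_const.mul (h1 ℓ)).add (contDiff_const.mul (h2 ℓ)))]
    refine Finset.sum_congr rfl fun ℓ _ => ?_
    rw [iteratedDeriv_fun_add (contDiff_const.mul (h1 ℓ)).contDiffAt
      (contDiff_const.mul (h2 ℓ)).contDiffAt, iteratedDeriv_const_mul_field,
      iteratedDeriv_const_mul_field, iteratedDeriv_comp_const_sub]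
    rfl
  have hpc : ContDiff ℝ k p := by
    refine ContDiff.sum fun ℓ _ => ?_
    have h1 := hf ℓ k
    have h2 : ContDiff ℝ k (fun t => f ℓ (T - t)) := h1.comp (by fun_prop)
    exact (contDiff_const.mul h1).add (contDiff_const.mul h2)
  have hp0 : ∀ j, iteratedDeriv j p 0 =
      if j ∈ Finset.Icc 1 (k - 1) then iteratedDeriv j v 0 else 0 := by
    intro j
    simp [hpd, hf0, hf1 _ _ T hT]
  have hpT : ∀ j, iteratedDeriv j p T =
      if j ∈ Finset.Icc 1 (k - 1) then iteratedDeriv j v T else 0 := by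
    intro j
    simp only [hpd, hf0, hf1 _ _ T hT, sub_self, mul_zero, zero_add, mul_ite, mul_one,
      Finset.sum_ite_eq]
    congr 1
    rw [mul_right_comm, ← mul_pow]
    simp
  have hsub : ∀ j ≤ k, ∀ t,
      iteratedDeriv j (fun t => v t - p t) t = iteratedDeriv j v t - iteratedDeriv j p t :=
    fun j hj t => iteratedDeriv_fun_sub (hv.of_le (mod_cast hj)).contDiffAt
      (hpc.of_le (mod_cast hj)).contDiffAt
  refine ⟨fun t => v t - p t, hv.sub hpc, fun j h1 h2 => ?_, ?_, fun t ht => ?_⟩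
  · rw [hsub j (by omega), hsub j (by omega), hp0, hpT, if_pos (Finset.mem_Icc.2 ⟨h1, h2⟩),
      if_pos (Finset.mem_Icc.2 ⟨h1, h2⟩)]
    simp
  · have h0 := hp0 0
    have h1 := hpT 0
    rw [if_neg (by simp), iteratedDeriv_zero] at h0 h1
    simp [h0, h1]
  · rw [hsub k le_rfl, sub_sub_cancel, hpd, Finset.mul_sum]
    refine (Finset.abs_sum_le_sum_abs _ _).trans (Finset.sum_le_sum fun ℓ hℓ => ?_)
    rw [Finset.mem_Icc] at hℓ
    obtain ⟨hb0, hbT⟩ := hb ℓ hℓ.1 hℓ.2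
    refine (abs_add_le _ _).trans ?_
    simp only [abs_mul, abs_pow, abs_neg, abs_one, one_pow, one_mul]
    have e1 := mul_le_mul hb0 (hC ℓ t ht.1) (abs_nonneg _) ((abs_nonneg _).trans hb0)
    have e2 := mul_le_mul hbT (hC ℓ (T - t) (sub_nonneg.2 ht.2)) (abs_nonneg _)
      ((abs_nonneg _).trans hbT)
    linarith

theorem integral_sq_le_of_abs_sub_le {f g : ℝ → ℝ} (hf : Continuous f) (hg : Continuous g)
    {T β η : ℝ} (hT : 0 ≤ T) (hη : 0 < η) (h : ∀ t ∈ Icc 0 T, |f t - g t| ≤ β) :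
    ∫ t in (0:ℝ)..T, g t ^ 2 ≤
      (1 + η) * (∫ t in (0:ℝ)..T, f t ^ 2) + (1 + η⁻¹) * (T * β ^ 2) := by
  have hle : ∫ t in (0:ℝ)..T, g t ^ 2 ≤
      ∫ t in (0:ℝ)..T, ((1 + η) * f t ^ 2 + (1 + η⁻¹) * β ^ 2) := by
    refine intervalIntegral.integral_mono_on hT (Continuous.intervalIntegrable (by fun_prop) _ _)
      (Continuous.intervalIntegrable (by fun_prop) _ _) fun t ht => ?_
    have h1 : (f t - g t) ^ 2 ≤ β ^ 2 :=
      sq_le_sq' (neg_le_of_abs_le (h t ht)) (le_of_abs_le (h t ht))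
    have h2 : g t ^ 2 + η⁻¹ * (η * f t + (f t - g t)) ^ 2 =
        (1 + η) * f t ^ 2 + (1 + η⁻¹) * (f t - g t) ^ 2 := by
      field_simp
      ring
    have h3 : 0 ≤ η⁻¹ * (η * f t + (f t - g t)) ^ 2 := by positivity
    have h4 : (1 + η⁻¹) * (f t - g t) ^ 2 ≤ (1 + η⁻¹) * β ^ 2 := by gcongr
    linarith
  refine hle.trans_eq ?_
  rw [intervalIntegral.integral_add (Continuous.intervalIntegrable (by fun_prop) _ _)
    (Continuous.intervalIntegrable (by fun_prop) _ _), intervalIntegral.integral_const_mul,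
    intervalIntegral.integral_const]
  simp
  ring

theorem abs_le_add_of_abs_deriv_le {f : ℝ → ℝ} (hf : Differentiable ℝ f) {T M : ℝ} (hT : T ≤ 1)
    (hM : ∀ t ∈ Icc 0 T, |deriv f t| ≤ M) :
    ∀ t ∈ Icc 0 T, |f t| ≤ |f 0| + M := by
  intro t ht
  have h := norm_image_sub_le_of_norm_deriv_le_segment' (f := f) (f' := deriv f) (C := M)
    (fun x _ => (hf x).hasDerivAt.hasDerivWithinAt)
    (fun x hx => hM x (Ico_subset_Icc_self hx)) t ht
  rw [Real.norm_eq_abs, sub_zero] at h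
  have hM0 : 0 ≤ M := (abs_nonneg _).trans (hM t ht)
  have h1 : M * t ≤ M := mul_le_of_le_one_right hM0 (ht.2.trans hT)
  have h2 := abs_sub_abs_le_abs_sub (f t) (f 0)
  linarith

/-- On an interval of length at most one, the derivatives of order `k - i` are controlled by the
endpoint bounds and the energy. -/
theorem abs_iteratedDeriv_le {k : ℕ} {T : ℝ} {v : ℝ → ℝ} (hT : 0 < T) (hT1 : T ≤ 1)
    (hv : ContDiff ℝ k v) (hb : EndpointBound k 1 T v) (i : ℕ) (hi : i + 2 ≤ k) :
    ∀ t ∈ Icc 0 T, |iteratedDeriv (k - (i + 1)) v t| ≤ i + 1 + transitionEnergy k T v := by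
  induction i with
  | zero =>
    intro t ht
    have hd : ∀ x, HasDerivAt (iteratedDeriv (k - 1) v) (iteratedDeriv k v x) x := by
      intro x
      have := (hv.differentiable_iteratedDeriv (k - 1) (mod_cast (by omega)) x).hasDerivAt
      rwa [← iteratedDeriv_succ, Nat.sub_add_cancel (by omega)] at this
    have hc : Continuous (iteratedDeriv k v) := hv.continuous_iteratedDeriv' k
    have hint := integral_eq_sub_of_hasDerivAt (fun x _ => hd x) (hc.intervalIntegrable 0 t)
    have h1 : |∫ s in (0:ℝ)..t, iteratedDeriv k v s| ≤ ∫ s in (0:ℝ)..t, |iteratedDeriv k v s| :=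
      abs_integral_le_integral_abs ht.1
    have h2 : ∫ s in (0:ℝ)..t, |iteratedDeriv k v s| ≤ ∫ s in (0:ℝ)..T, |iteratedDeriv k v s| :=
      integral_mono_interval le_rfl ht.1 ht.2 (Eventually.of_forall fun s => abs_nonneg _)
        (hc.abs.intervalIntegrable _ _)
    have h3 : ∫ s in (0:ℝ)..T, |iteratedDeriv k v s| ≤
        ∫ s in (0:ℝ)..T, (1 + iteratedDeriv k v s ^ 2) := by
      refine intervalIntegral.integral_mono_on hT.le (hc.abs.intervalIntegrable _ _)
        (Continuous.intervalIntegrable (by fun_prop) _ _) fun s _ => ?_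
      nlinarith [sq_nonneg (|iteratedDeriv k v s| - 1), sq_abs (iteratedDeriv k v s),
        abs_nonneg (iteratedDeriv k v s)]
    have h4 : ∫ s in (0:ℝ)..T, (1 + iteratedDeriv k v s ^ 2) = transitionEnergy k T v := by
      rw [intervalIntegral.integral_add (by simp) (Continuous.intervalIntegrable (by fun_prop) _ _)]
      simp [transitionEnergy]
    have h5 := (hb (k - 1) (by omega) le_rfl).1
    have h6 := abs_sub_abs_le_abs_sub (iteratedDeriv (k - 1) v t) (iteratedDeriv (k - 1) v 0)
    rw [hint] at h1
    simp only [Nat.cast_zero, zero_add]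
    linarith
  | succ i ih =>
    intro t ht
    have hd : Differentiable ℝ (iteratedDeriv (k - (i + 1 + 1)) v) :=
      hv.differentiable_iteratedDeriv _ (mod_cast (by omega))
    have := abs_le_add_of_abs_deriv_le hd hT1 (fun s hs => by
      rw [← iteratedDeriv_succ, show k - (i + 1 + 1) + 1 = k - (i + 1) by omega]
      exact ih (by omega) s hs) t ht
    have h5 := (hb (k - (i + 1 + 1)) (by omega) (by omega)).1
    push_cast
    linarith

theorem abs_sub_le_mul_energy {k : ℕ} (hk : 2 ≤ k) {T : ℝ} {v : ℝ → ℝ} (hT : 0 < T) (hT1 : T ≤ 1)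
    (hv : ContDiff ℝ k v) (hb : EndpointBound k 1 T v) :
    |v T - v 0| ≤ (k + transitionEnergy k T v) * T := by
  have hd : Differentiable ℝ v := hv.differentiable (mod_cast (by omega))
  have h := abs_iteratedDeriv_le hT hT1 hv hb (k - 2) (by omega)
  rw [show k - (k - 2 + 1) = 1 by omega, Nat.cast_sub hk, iteratedDeriv_one] at h
  have h' := norm_image_sub_le_of_norm_deriv_le_segment' (f := v) (f' := deriv v)
    (C := k + transitionEnergy k T v) (fun x _ => (hd x).hasDerivAt.hasDerivWithinAt)
    (fun x hx => (h x (Ico_subset_Icc_self hx)).trans (by push_cast; linarith)) T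
    (right_mem_Icc.2 hT.le)
  simpa using h'

theorem eventually_mkConst_mul_le_phiN_add {k : ℕ} (hk : 2 ≤ k) {δ ε : ℝ} (R : ℝ) (hδ : 0 < δ)
    (hε : 0 < ε) : ∀ᶠ N : ℕ in atTop, ∀ z : ℝ, δ ≤ |z| → |z| ≤ R →
      mkConst k * |z| ^ ((1:ℝ) / k) ≤ phiN k N z + ε := by
  set B : ℝ := mkConst k * |R| ^ ((1:ℝ) / k) + 1 with hB
  have hB0 : 0 < B := by
    have := mkConst_nonneg k
    positivity
  set τ : ℝ := min 1 (δ / (k + B)) with hτ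
  have hτ0 : 0 < τ := by positivity
  obtain ⟨C, hC0, hC⟩ := exists_clamped_near k hτ0
  set η : ℝ := ε / (4 * B) with hη
  have hη0 : 0 < η := by positivity
  have hlim : Tendsto (fun N : ℕ => (1 + η⁻¹) * (B * (1 / (N:ℝ) * C) ^ 2)) atTop (𝓝 0) := by
    have h := tendsto_one_div_atTop_nhds_zero_nat (𝕜 := ℝ)
    simpa using (((h.mul_const C).pow 2).const_mul B).const_mul (1 + η⁻¹)
  filter_upwards [hlim.eventually_lt_const (show 0 < ε / 4 by positivity),
    eventually_ge_atTop 1] with N hN hN1 z hzδ hzR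
  have hz : z ≠ 0 := abs_pos.1 (hδ.trans_le hzδ)
  obtain ⟨T, hT, v, hv, hb, rfl, hlt⟩ := exists_energy_lt_of_phiN_lt (k := k) (by omega) hz
    (show phiN k N z < phiN k N z + min 1 (ε / 2) by
      have : 0 < min 1 (ε / 2) := by positivity
      linarith)
  set z := v T - v 0
  have hEB : transitionEnergy k T v ≤ B := by
    have h1 := phiN_le_mkConst_mul (k := k) (by omega) N z
    have h2 : mkConst k * |z| ^ ((1:ℝ) / k) ≤ mkConst k * |R| ^ ((1:ℝ) / k) := by
      exact mul_le_mul_of_nonneg_left (Real.rpow_le_rpow (abs_nonneg _)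
        (hzR.trans (le_abs_self R)) (by positivity)) (mkConst_nonneg k)
    have h3 := min_le_left 1 (ε / 2)
    linarith
  have hN1' : (1:ℝ) / N ≤ 1 := by
    have : (1:ℝ) ≤ N := mod_cast hN1
    exact div_le_one_of_le₀ this (by positivity)
  have hτT : τ ≤ T := by
    rcases le_total T 1 with h | h
    · refine (min_le_right _ _).trans ?_
      have h1 := abs_sub_le_mul_energy hk hT h hv (hb.mono hN1')
      rw [div_le_iff₀ (by positivity), mul_comm]
      refine (hzδ.trans h1).trans ?_
      gcongr
    · exact (min_le_left _ _).trans h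
  obtain ⟨w, hw, hwb, hwz, hwd⟩ := hC _ T hτT v hv hb
  have h1 := mkConst_mul_rpow_le (by omega) hT hw hwb (by rwa [hwz])
  rw [hwz] at h1
  have h2 := integral_sq_le_of_abs_sub_le (hv.continuous_iteratedDeriv' k)
    (hw.continuous_iteratedDeriv' k) hT.le hη0 hwd
  have hI := integral_sq_nonneg hT (iteratedDeriv k v)
  unfold transitionEnergy at h1 hEB hlt
  have h3 : η * (∫ t in (0:ℝ)..T, iteratedDeriv k v t ^ 2) ≤ ε / 4 := by
    calc _ ≤ η * B := by gcongr; linarith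
      _ = ε / 4 := by rw [hη]; field_simp
  have h4 : (1 + η⁻¹) * (T * (1 / (N:ℝ) * C) ^ 2) ≤ (1 + η⁻¹) * (B * (1 / (N:ℝ) * C) ^ 2) := by
    gcongr
    linarith
  have h5 := min_le_right 1 (ε / 2)
  linarith

theorem tendstoUniformlyOn_phiN {k : ℕ} (hk : 2 ≤ k) {K : Set ℝ} (hK : IsCompact K)
    (h0 : 0 ∉ K) : TendstoUniformlyOn (fun (N : ℕ) (z : ℝ) => phiN k N z)
      (fun z : ℝ => mkConst k * |z| ^ ((1:ℝ) / (k:ℝ))) atTop K := by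
  obtain ⟨δ, hδ, hδK⟩ := Metric.isOpen_iff.1 hK.isClosed.isOpen_compl 0 h0
  obtain ⟨R, hR⟩ := hK.isBounded.exists_norm_le
  rw [Metric.tendstoUniformlyOn_iff]
  intro ε hε
  filter_upwards [eventually_mkConst_mul_le_phiN_add hk R hδ (half_pos hε)] with N hN z hz
  have hzδ : δ ≤ |z| := by
    by_contra! h
    exact hδK (by simpa using h) hz
  have h1 := hN z hzδ (hR z hz)
  have h2 := phiN_le_mkConst_mul (k := k) (by omega) N z
  rw [Real.dist_eq, abs_of_nonneg (by linarith)]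
  linarith

theorem stmt_10 (k : ℕ) (hk : 2 ≤ k) :
    (∀ z : ℝ, ∀ N M : ℕ, 1 ≤ N → N ≤ M → phiN k N z ≤ phiN k M z) ∧
    (∀ z : ℝ, ∀ N : ℕ, 1 ≤ N → phiN k N z ≤ mkConst k * |z| ^ ((1:ℝ)/(k:ℝ))) ∧
    (∀ z : ℝ, Tendsto (fun N : ℕ => phiN k N z) atTop (𝓝 (mkConst k * |z| ^ ((1:ℝ)/(k:ℝ))))) ∧
    (∀ K : Set ℝ, IsCompact K → 0 ∉ K →
      TendstoUniformlyOn (fun (N : ℕ) (z : ℝ) => phiN k N z)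
        (fun z : ℝ => mkConst k * |z| ^ ((1:ℝ)/(k:ℝ))) atTop K) := by
  refine ⟨fun z N M hN hNM => phiN_mono (by omega) z hN hNM,
    fun z N _ => phiN_le_mkConst_mul (by omega) N z, fun z => ?_,
    fun K hK h0 => tendstoUniformlyOn_phiN hk hK h0⟩
  rcases eq_or_ne z 0 with rfl | hz
  · have : (k:ℝ)⁻¹ ≠ 0 := inv_ne_zero (mod_cast (by omega))
    simp [phiN_zero, Real.zero_rpow this]
  · exact (tendstoUniformlyOn_phiN hk isCompact_singleton (by simpa using hz.symm)).tendsto_at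
      (mem_singleton z)
end

section
/- Let k ≥ 2 be an integer. For every z ∈ ℝ with z ≠ 0 one has inf{ T + ∫_0^T |v^{(k)}(t)|² dt : T > 0, v : ℝ → ℝ of class C^k, v(T) − v(0) = z, and v^{(ℓ)}(0) = v^{(ℓ)}(T) = 0 for all ℓ ∈ {1,…,k−1} } = m_k·|z|^{1/k}. -/
open Real Filter Topology Set MeasureTheory intervalIntegral

/-- The energies `T + ∫_0^T |v^{(k)}|²` of `C^k` functions with `v(T) - v(0) = z` whose derivatives
of orders `1, …, k-1` vanish at `0` and `T`. -/
def transitionEnergies (k : ℕ) (z : ℝ) : Set ℝ :=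
  {E : ℝ | ∃ T : ℝ, 0 < T ∧ ∃ v : ℝ → ℝ, ContDiff ℝ (k : ℕ∞) v ∧
    v T - v 0 = z ∧
    (∀ ℓ : ℕ, 1 ≤ ℓ → ℓ ≤ k - 1 →
      iteratedDeriv ℓ v 0 = 0 ∧ iteratedDeriv ℓ v T = 0) ∧
    E = T + ∫ t in (0:ℝ)..T, (iteratedDeriv k v t) ^ 2}

theorem iteratedDeriv_const_add_const_mul_comp_const_mul {n : ℕ} (hn : 0 < n) {v : ℝ → ℝ}
    (hv : ContDiff ℝ n v) (d c μ x : ℝ) :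
    iteratedDeriv n (fun t => d + c * v (μ * t)) x = c * (μ ^ n * iteratedDeriv n v (μ * x)) := by
  rw [iteratedDeriv_const_add hn, iteratedDeriv_const_mul_field, iteratedDeriv_comp_const_mul hv]

theorem mkConst_eq_sInf_transitionEnergies {k : ℕ} (hk : 0 < k) :
    mkConst k = sInf (transitionEnergies k 1) := by
  unfold mkConst
  congr 1
  ext E
  constructor
  · rintro ⟨T, hT, v, hv, h0, h1, hd, hE⟩
    exact ⟨T, hT, v, hv, by rw [h0, h1, sub_zero], hd, hE⟩
  · rintro ⟨T, hT, v, hv, hz, hd, hE⟩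
    have key : ∀ n, 0 < n → ∀ x, iteratedDeriv n (fun t => -v 0 + v t) x = iteratedDeriv n v x :=
      fun n hn x => iteratedDeriv_const_add hn _
    refine ⟨T, hT, fun t => -v 0 + v t, contDiff_const.add hv, by ring, by linarith, ?_, ?_⟩
    · intro ℓ h1 h2
      rw [key ℓ h1, key ℓ h1]
      exact hd ℓ h1 h2
    · simp_rw [key k hk]
      exact hE

theorem inv_mul_mem_transitionEnergies {k : ℕ} (hk : 0 < k) {z E c μ : ℝ} (hμ : 0 < μ)
    (hc : c ^ 2 * μ ^ (2 * k) = 1) (hE : E ∈ transitionEnergies k z) :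
    μ⁻¹ * E ∈ transitionEnergies k (c * z) := by
  obtain ⟨T, hT, v, hv, hz, hd, rfl⟩ := hE
  have key : ∀ n, 0 < n → n ≤ k → ∀ x, iteratedDeriv n (fun t => 0 + c * v (μ * t)) x
      = c * (μ ^ n * iteratedDeriv n v (μ * x)) := fun n hn hnk x =>
    iteratedDeriv_const_add_const_mul_comp_const_mul hn (hv.of_le (by exact_mod_cast hnk)) 0 c μ x
  have hμT : μ * (μ⁻¹ * T) = T := mul_inv_cancel_left₀ hμ.ne' T
  refine ⟨μ⁻¹ * T, by positivity, fun t => 0 + c * v (μ * t),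
    contDiff_const.add (contDiff_const.mul (hv.comp (contDiff_const.mul contDiff_id))), ?_, ?_, ?_⟩
  · simp only [hμT, mul_zero, ← hz]
    ring
  · intro ℓ h1 h2
    rw [key ℓ h1 (by omega), key ℓ h1 (by omega), hμT, mul_zero, (hd ℓ h1 h2).1, (hd ℓ h1 h2).2]
    simp
  · have hsq : ∀ x, (iteratedDeriv k (fun t => 0 + c * v (μ * t)) x) ^ 2
        = (iteratedDeriv k v (μ * x)) ^ 2 := fun x => by
      rw [key k hk le_rfl]
      linear_combination (iteratedDeriv k v (μ * x)) ^ 2 * hc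
    simp_rw [hsq]
    rw [intervalIntegral.integral_comp_mul_left (fun x => (iteratedDeriv k v x) ^ 2) hμ.ne', hμT,
      mul_zero, smul_eq_mul, mul_add]

open scoped Pointwise in
theorem transitionEnergies_mul_pow {k : ℕ} (hk : 0 < k) {s r : ℝ} (hs : s ^ 2 = 1) (hr : 0 < r) :
    transitionEnergies k (s * r ^ k) = r • transitionEnergies k 1 := by
  have hr' : r ≠ 0 := hr.ne'
  ext E
  rw [Set.mem_smul_set_iff_inv_smul_mem₀ hr', smul_eq_mul]
  constructor
  · intro hE
    have h := inv_mul_mem_transitionEnergies (c := s * (r ^ k)⁻¹) hk hr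
      (by rw [mul_pow, hs, inv_pow, one_mul, ← pow_mul', inv_mul_cancel₀ (by positivity)]) hE
    rwa [show s * (r ^ k)⁻¹ * (s * r ^ k) = 1 by field_simp; exact hs] at h
  · intro hE
    have h := inv_mul_mem_transitionEnergies (c := s * r ^ k) hk (inv_pos.2 hr)
      (by rw [mul_pow, hs, inv_pow, one_mul, ← pow_mul', mul_inv_cancel₀ (by positivity)]) hE
    rwa [inv_inv, mul_inv_cancel_left₀ hr', mul_one] at h

theorem stmt_12 (k : ℕ) (hk : 2 ≤ k) (z : ℝ) (hz : z ≠ 0) :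
    sInf {E : ℝ | ∃ T : ℝ, 0 < T ∧ ∃ v : ℝ → ℝ, ContDiff ℝ (k : ℕ∞) v ∧
        v T - v 0 = z ∧
        (∀ ℓ : ℕ, 1 ≤ ℓ → ℓ ≤ k - 1 →
          iteratedDeriv ℓ v 0 = 0 ∧ iteratedDeriv ℓ v T = 0) ∧
        E = T + ∫ t in (0:ℝ)..T, (iteratedDeriv k v t) ^ 2} =
      mkConst k * |z| ^ ((1:ℝ)/(k:ℝ)) := by
  have hk0 : 0 < k := by omega
  have hr : 0 < |z| ^ ((1:ℝ) / (k:ℝ)) := Real.rpow_pos_of_pos (abs_pos.2 hz) _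
  have hs : SignType.sign z * (|z| ^ ((1:ℝ) / (k:ℝ))) ^ k = z := by
    rw [one_div, Real.rpow_inv_natCast_pow (abs_nonneg z) hk0.ne', sign_mul_abs]
  have hs2 : ((SignType.sign z : SignType) : ℝ) ^ 2 = 1 := by
    rcases hz.lt_or_gt with h | h <;> simp [h]
  change sInf (transitionEnergies k z) = _
  rw [mkConst_eq_sInf_transitionEnergies hk0, mul_comm, ← smul_eq_mul,
    ← Real.sInf_smul_of_nonneg hr.le, ← transitionEnergies_mul_pow hk0 hs2 hr, hs]
end

section
/- Let p : (0,1) → (0,∞) be an admissible exponent family with c_ε := ε^{p(ε)}, let S > 0, and for each ε ∈ (0,1) let u_ε : ℝ → ℝ be of class C¹ with ∫_0^1 (1/(ε·|log ε|))·log(1 + ε·|log ε|·u_ε'(t)²) dt ≤ S. Set D_ε := { t ∈ (0,1) : u_ε'(t)² > √(c_ε)/(ε·√(|log ε|)) }. Then (c_ε/ε)·λ(D_ε) → 0 as ε → 0⁺, where λ denotes Lebesgue measure. -/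
open Real Filter Topology Set MeasureTheory intervalIntegral

theorem half_le_log_one_add {s : ℝ} (h0 : 0 ≤ s) (h1 : s ≤ 1) : s / 2 ≤ Real.log (1 + s) := by
  refine le_trans ?_ (Real.one_sub_inv_le_log_of_pos (by linarith : 0 < 1 + s))
  have h : 1 - (1 + s)⁻¹ = s / (1 + s) := by
    field_simp
    ring
  rw [h]
  gcongr
  linarith

/-- A Chebyshev estimate for the superlevel sets of `v ^ 2` in terms of the logarithmic energy. -/
theorem mul_volume_superlevel_le_of_log_energy_le {v : ℝ → ℝ} (hv : Continuous v)
    {ε L c S : ℝ} (hε : 0 < ε) (hL : 0 < L) (hc : 0 < c) (hcL : c * L ≤ 1)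
    (hS : (∫ t in (0:ℝ)..1, (1 / (ε * L)) * Real.log (1 + ε * L * (v t) ^ 2)) ≤ S) :
    c / ε * (volume {t ∈ Set.Ioo (0:ℝ) 1 |
      Real.sqrt c / (ε * Real.sqrt L) < (v t) ^ 2}).toReal ≤ 2 * S * Real.sqrt (c * L) := by
  set s := Real.sqrt (c * L) with hs
  have hs0 : 0 < s := Real.sqrt_pos.2 (by positivity)
  have hs1 : s ≤ 1 := Real.sqrt_le_one.2 hcL
  have hss : s * s = c * L := Real.mul_self_sqrt (by positivity)
  set f : ℝ → ℝ := fun t => (1 / (ε * L)) * Real.log (1 + ε * L * (v t) ^ 2) with hf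
  have hpos : ∀ t, 0 < 1 + ε * L * (v t) ^ 2 := fun t => by positivity
  have hf0 : ∀ t, 0 ≤ f t := fun t =>
    mul_nonneg (by positivity) (Real.log_nonneg (le_add_of_nonneg_right (by positivity)))
  have hfc : Continuous f :=
    continuous_const.mul (Continuous.log (by fun_prop) fun t => (hpos t).ne')
  have hint : Integrable f (volume.restrict (Set.Ioc (0:ℝ) 1)) :=
    (hfc.intervalIntegrable 0 1).1
  set a := 1 / (ε * L) * (s / 2) with ha
  have hmarkov := mul_meas_ge_le_integral_of_nonneg (Filter.Eventually.of_forall hf0) hint a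
  rw [← intervalIntegral.integral_of_le zero_le_one] at hmarkov
  have hmono : (volume {t ∈ Set.Ioo (0:ℝ) 1 |
      Real.sqrt c / (ε * Real.sqrt L) < (v t) ^ 2}).toReal
      ≤ (volume.restrict (Set.Ioc (0:ℝ) 1)).real {t | a ≤ f t} := by
    rw [Measure.real, Measure.restrict_apply' measurableSet_Ioc]
    refine ENNReal.toReal_mono ?_ (measure_mono ?_)
    · exact ((measure_mono Set.inter_subset_right).trans_lt measure_Ioc_lt_top).ne
    · rintro t ⟨ht, hlt⟩
      refine ⟨?_, Set.Ioo_subset_Ioc_self ht⟩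
      have hsL : 0 < Real.sqrt L := Real.sqrt_pos.2 hL
      have hle : s ≤ ε * L * (v t) ^ 2 := by
        rw [div_lt_iff₀ (by positivity)] at hlt
        calc s = Real.sqrt c * Real.sqrt L := Real.sqrt_mul hc.le L
          _ ≤ (v t) ^ 2 * (ε * Real.sqrt L) * Real.sqrt L := by gcongr
          _ = ε * (Real.sqrt L * Real.sqrt L) * (v t) ^ 2 := by ring
          _ = ε * L * (v t) ^ 2 := by rw [Real.mul_self_sqrt hL.le]
      have hlog : s / 2 ≤ Real.log (1 + ε * L * (v t) ^ 2) :=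
        (half_le_log_one_add hs0.le hs1).trans (Real.log_le_log (by linarith) (by linarith))
      exact mul_le_mul_of_nonneg_left hlog (by positivity)
  have hac : c / ε = 2 * s * a := by
    rw [ha]
    field_simp
    linarith
  have ha0 : 0 < a := by positivity
  calc _ ≤ 2 * s * a * (volume.restrict (Set.Ioc (0:ℝ) 1)).real {t | a ≤ f t} := by
        rw [hac]
        gcongr
    _ = 2 * s * (a * (volume.restrict (Set.Ioc (0:ℝ) 1)).real {t | a ≤ f t}) := by ring
    _ ≤ 2 * s * S := by
        gcongr
        exact hmarkov.trans hS
    _ = 2 * S * s := by ring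

theorem tendsto_neg_log_nhdsGT_zero :
    Tendsto (fun ε : ℝ => -Real.log ε) (𝓝[>] (0:ℝ)) atTop :=
  tendsto_neg_atBot_atTop.comp Real.tendsto_log_nhdsGT_zero

theorem IsAdmissibleExponent.eventually_rpow_mul_neg_log_le {p : ℝ → ℝ}
    (hp : IsAdmissibleExponent p) :
    ∀ᶠ ε in 𝓝[>] (0:ℝ), ε ^ p ε * (-Real.log ε) ≤ (-Real.log ε)⁻¹ := by
  filter_upwards [Ioo_mem_nhdsGT (zero_lt_one' ℝ),
    hp.2.2.eventually_lt_const (show (0:ℝ) < 1 / 2 by norm_num)] with ε hε hr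
  have hL : 0 < -Real.log ε := neg_pos.2 (Real.log_neg hε.1 hε.2)
  have hpL : 0 < p ε * (-Real.log ε) := mul_pos (hp.1 ε hε) hL
  rw [div_lt_iff₀ hpL] at hr
  have hc : ε ^ p ε ≤ (-Real.log ε)⁻¹ * (-Real.log ε)⁻¹ := by
    calc ε ^ p ε = Real.exp (Real.log ε * p ε) := Real.rpow_def_of_pos hε.1 _
      _ ≤ Real.exp (-Real.log (-Real.log ε) + -Real.log (-Real.log ε)) :=
        Real.exp_le_exp.2 (by linarith)
      _ = _ := by rw [Real.exp_add, Real.exp_neg, Real.exp_log hL]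
  calc _ ≤ (-Real.log ε)⁻¹ * (-Real.log ε)⁻¹ * (-Real.log ε) := by gcongr
    _ = _ := by rw [mul_assoc, inv_mul_cancel₀ hL.ne', mul_one]

theorem stmt_13 (p : ℝ → ℝ) (hp : IsAdmissibleExponent p) (S : ℝ) (hS : 0 < S)
    (u : ℝ → ℝ → ℝ) (hu : ∀ ε ∈ Set.Ioo (0:ℝ) 1, ContDiff ℝ 1 (u ε))
    (hbound : ∀ ε ∈ Set.Ioo (0:ℝ) 1,
      (∫ t in (0:ℝ)..1,
        (1 / (ε * (-Real.log ε))) * Real.log (1 + ε * (-Real.log ε) * (deriv (u ε) t) ^ 2)) ≤ S) :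
    Tendsto (fun ε : ℝ => (ε ^ p ε / ε) *
        (volume {t ∈ Set.Ioo (0:ℝ) 1 |
          Real.sqrt (ε ^ p ε) / (ε * Real.sqrt (-Real.log ε)) < (deriv (u ε) t) ^ 2}).toReal)
      (𝓝[>] (0:ℝ)) (𝓝 0) := by
  have hlim : Tendsto (fun ε : ℝ => 2 * S * Real.sqrt (-Real.log ε)⁻¹) (𝓝[>] (0:ℝ)) (𝓝 0) := by
    simpa using ((tendsto_inv_atTop_zero.comp tendsto_neg_log_nhdsGT_zero).sqrt).const_mul (2 * S)
  refine squeeze_zero' ?_ ?_ hlim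
  · filter_upwards [Ioo_mem_nhdsGT (zero_lt_one' ℝ)] with ε hε
    have := hε.1
    positivity
  · filter_upwards [Ioo_mem_nhdsGT (zero_lt_one' ℝ), hp.eventually_rpow_mul_neg_log_le,
      tendsto_neg_log_nhdsGT_zero.eventually_ge_atTop 1] with ε hε hc hL
    refine (mul_volume_superlevel_le_of_log_energy_le ((hu ε hε).continuous_deriv le_rfl) hε.1
      (by linarith) (Real.rpow_pos_of_pos hε.1 _) (hc.trans (inv_le_one_of_one_le₀ hL))
      (hbound ε hε)).trans ?_
    gcongr
end

section
/- Let p : (0,1) → (0,∞) be an admissible exponent family with c_ε := ε^{p(ε)}. For every η ∈ (0,1) there exists ε₀ ∈ (0,1) such that for all ε ∈ (0,ε₀) and all z ∈ ℝ with z² ≤ √(c_ε)/(ε·√(|log ε|)) one has (1−η)·z² ≤ (1/(ε·|log ε|))·log(1 + ε·|log ε|·z²). -/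
open Real Filter Topology Set

/-- The elementary bound `(1 - η) x ≤ log (1 + x)` for `0 ≤ x ≤ η`. -/
lemma one_sub_mul_le_log_one_add {η x : ℝ} (hx : 0 ≤ x) (hxη : x ≤ η) :
    (1 - η) * x ≤ Real.log (1 + x) := by
  have hpos : 0 < 1 + x := by linarith
  refine le_trans ?_ (Real.one_sub_inv_le_log_of_pos hpos)
  have h : 1 - (1 + x)⁻¹ = x / (1 + x) := by
    field_simp
    ring
  rw [h, le_div_iff₀ hpos]
  nlinarith [mul_nonneg hx (sub_nonneg.2 hxη), mul_nonneg (hx.trans hxη) (sq_nonneg x)]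

/-- If `2 log |log ε| ≤ q |log ε|`, then `√(ε ^ q) ≤ 1 / |log ε|`. -/
lemma sqrt_rpow_le_inv_neg_log {ε q : ℝ} (hε : 0 < ε) (hL : 0 < -Real.log ε)
    (h : 2 * Real.log (-Real.log ε) ≤ q * (-Real.log ε)) :
    Real.sqrt (ε ^ q) ≤ (-Real.log ε)⁻¹ := by
  refine Real.sqrt_le_iff.2 ⟨(inv_pos.2 hL).le, ?_⟩
  have hsq : ((-Real.log ε)⁻¹) ^ 2 = Real.exp (-(2 * Real.log (-Real.log ε))) := by
    rw [Real.exp_neg, two_mul, Real.exp_add, Real.exp_log hL, inv_pow, sq]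
  rw [hsq, Real.rpow_def_of_pos hε]
  exact Real.exp_le_exp.2 (by linarith)

theorem stmt_14 (p : ℝ → ℝ) (hp : IsAdmissibleExponent p) :
    ∀ η ∈ Set.Ioo (0:ℝ) 1, ∃ ε₀ ∈ Set.Ioo (0:ℝ) 1, ∀ ε ∈ Set.Ioo (0:ℝ) ε₀, ∀ z : ℝ,
      z ^ 2 ≤ Real.sqrt (ε ^ p ε) / (ε * Real.sqrt (-Real.log ε)) →
      (1 - η) * z ^ 2 ≤
        (1 / (ε * (-Real.log ε))) * Real.log (1 + ε * (-Real.log ε) * z ^ 2) := by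
  rintro η ⟨hη, -⟩
  obtain ⟨hpos, -, hlim⟩ := hp
  have hlog : Tendsto (fun ε : ℝ => -Real.log ε) (𝓝[>] (0:ℝ)) atTop :=
    tendsto_neg_atBot_atTop.comp Real.tendsto_log_nhdsGT_zero
  have hev := (hlim.eventually_lt_const (show (0:ℝ) < 1 / 2 by norm_num)).and
    (hlog.eventually_ge_atTop ((η⁻¹) ^ 2))
  obtain ⟨u, hu, hsub⟩ := mem_nhdsGT_iff_exists_Ioo_subset.1 hev
  have hu0 : 0 < u := hu
  refine ⟨min u (1 / 2), ⟨by positivity, by linarith [min_le_right u (1 / 2)]⟩, ?_⟩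
  rintro ε ⟨hε, hεu⟩ z hz
  obtain ⟨hratio, hL⟩ := hsub ⟨hε, hεu.trans_le (min_le_left _ _)⟩
  have hε1 : ε < 1 := by linarith [min_le_right u (1 / 2)]
  have hL0 : 0 < -Real.log ε := neg_pos.2 (Real.log_neg hε hε1)
  have hs : Real.sqrt (ε ^ p ε) ≤ (-Real.log ε)⁻¹ := by
    refine sqrt_rpow_le_inv_neg_log hε hL0 ?_
    rw [div_lt_iff₀ (mul_pos (hpos ε ⟨hε, hε1⟩) hL0)] at hratio
    linarith
  generalize -Real.log ε = L at *
  have hr : 0 < Real.sqrt L := Real.sqrt_pos.2 hL0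
  have hrη : η⁻¹ ≤ Real.sqrt L := Real.le_sqrt_of_sq_le hL
  have hx : ε * L * z ^ 2 ≤ η := by
    calc ε * L * z ^ 2 ≤ ε * L * (L⁻¹ / (ε * Real.sqrt L)) := by
          refine mul_le_mul_of_nonneg_left (hz.trans ?_) (by positivity)
          gcongr
      _ = (Real.sqrt L)⁻¹ := by field_simp
      _ ≤ η := inv_le_of_inv_le₀ hη hrη
  have hmain := one_sub_mul_le_log_one_add (by positivity) hx
  rw [one_div, ← div_eq_inv_mul, le_div_iff₀ (by positivity)]
  linarith
end

section
/- Let k ≥ 1 be an integer, T̄ > 0, v̄ : ℝ → ℝ of class C^k, and z ∈ ℝ with z ≠ 0. For ε ∈ (0,1) set L_ε := |z|^{1/k}·T̄·ε and u_ε(x) := z·v̄(x/(ε·|z|^{1/k})) for x ∈ ℝ. Then limsup_{ε → 0⁺} [ ∫_0^{L_ε} (1/(ε·|log ε|))·log(1 + ε·|log ε|·u_ε'(x)²) dx + ε^{2k−1}·∫_0^{L_ε} |u_ε^{(k)}(x)|² dx ] ≤ |z|^{1/k}·( T̄ + ∫_0^{T̄} |v̄^{(k)}(t)|² dt ). -/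
open Real Filter Topology Set MeasureTheory intervalIntegral

/-- The `L²` energy of order `k` of a rescaled profile `z * v (· / (ε * c))` with `c ^ k = |z|`
does not depend on `ε` after renormalisation by `ε ^ (2 * k - 1)`. -/
lemma rescaled_iteratedDeriv_energy {k : ℕ} (hk : 1 ≤ k) (T : ℝ) {v : ℝ → ℝ}
    (hv : ContDiff ℝ k v) {z c ε : ℝ} (hc : 0 < c) (hcz : c ^ k = |z|) (hε : 0 < ε) :
    ε ^ (2 * k - 1) * ∫ x in (0:ℝ)..(c * T * ε),
      (iteratedDeriv k (fun y : ℝ => z * v (y / (ε * c))) x) ^ 2 =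
    c * ∫ t in (0:ℝ)..T, (iteratedDeriv k v t) ^ 2 := by
  have hd : ∀ x, iteratedDeriv k (fun y : ℝ => z * v (y / (ε * c))) x =
      z * (((ε * c)⁻¹) ^ k * iteratedDeriv k v (x / (ε * c))) := fun x => by
    have h := congrFun (iteratedDeriv_comp_const_mul hv ((ε * c)⁻¹)) x
    rw [iteratedDeriv_const_mul_field]
    simp only [div_eq_inv_mul] at h ⊢
    rw [h]
  simp only [hd, mul_pow, intervalIntegral.integral_const_mul]
  rw [intervalIntegral.integral_comp_div (fun x => iteratedDeriv k v x ^ 2) (by positivity),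
    zero_div, show c * T * ε / (ε * c) = T by field_simp, ← sq_abs z, ← hcz, smul_eq_mul]
  obtain ⟨n, rfl⟩ : ∃ n, k = n + 1 := ⟨k - 1, by omega⟩
  rw [show 2 * (n + 1) - 1 = 2 * n + 1 by omega, inv_pow]
  field_simp
  ring

/-- Pointwise bound on the logarithmic energy density of a gradient of size `D / ε`. -/
lemma log_one_add_mul_div_sq_le {ε l A D : ℝ} (hε : 0 < ε) (hε1 : ε ≤ 1) (hl : 1 ≤ l)
    (hA : 0 ≤ A) (hD : D ^ 2 ≤ A) :
    log (1 + ε * l * (D / ε) ^ 2) ≤ log (1 + A) + log l - log ε := by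
  have hl0 : 0 < l := by linarith
  rw [← log_mul (by positivity) hl0.ne', ← log_div (by positivity) hε.ne']
  refine log_le_log (by positivity) ?_
  rw [le_div_iff₀ hε]
  have h : (1 + ε * l * (D / ε) ^ 2) * ε = ε + l * D ^ 2 := by field_simp
  rw [h]
  nlinarith [mul_le_mul_of_nonneg_left hD hl0.le]

lemma tendsto_const_add_log_div_atTop (a : ℝ) :
    Tendsto (fun l : ℝ => (a + log l) / l) atTop (𝓝 0) := by
  have h : Tendsto (fun l : ℝ => a / l + log l / l) atTop (𝓝 (0 + 0)) :=
    (tendsto_const_nhds.div_atTop tendsto_id).add isLittleO_log_id_atTop.tendsto_div_nhds_zero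
  simpa only [add_div, add_zero] using h

theorem stmt_16 (k : ℕ) (hk : 1 ≤ k) (T : ℝ) (hT : 0 < T)
    (v : ℝ → ℝ) (hv : ContDiff ℝ (k : ℕ∞) v) (z : ℝ) (hz : z ≠ 0) :
    Filter.limsup (fun ε : ℝ =>
        (∫ x in (0:ℝ)..(|z| ^ ((1:ℝ)/(k:ℝ)) * T * ε),
          (1 / (ε * (-Real.log ε))) * Real.log (1 + ε * (-Real.log ε) *
            (deriv (fun y : ℝ => z * v (y / (ε * |z| ^ ((1:ℝ)/(k:ℝ))))) x) ^ 2)) +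
        ε ^ (2 * k - 1) * ∫ x in (0:ℝ)..(|z| ^ ((1:ℝ)/(k:ℝ)) * T * ε),
          (iteratedDeriv k (fun y : ℝ => z * v (y / (ε * |z| ^ ((1:ℝ)/(k:ℝ))))) x) ^ 2)
      (𝓝[>] (0:ℝ)) ≤
    |z| ^ ((1:ℝ)/(k:ℝ)) * (T + ∫ t in (0:ℝ)..T, (iteratedDeriv k v t) ^ 2) := by
  have hc : 0 < |z| ^ ((1:ℝ)/(k:ℝ)) := rpow_pos_of_pos (abs_pos.2 hz) _
  have hcz : (|z| ^ ((1:ℝ)/(k:ℝ))) ^ k = |z| := by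
    rw [one_div]
    exact rpow_inv_natCast_pow (abs_nonneg z) (by omega)
  generalize |z| ^ ((1:ℝ)/(k:ℝ)) = c at hc hcz ⊢
  have hv' : ContDiff ℝ k v := by exact_mod_cast hv
  have hcont : Continuous (deriv v) := hv'.continuous_deriv (by exact_mod_cast hk)
  have hderiv : ∀ ε x : ℝ, deriv (fun y : ℝ => z * v (y / (ε * c))) x =
      z * deriv v (x / (ε * c)) / c / ε := fun ε x => by
    have h := deriv_comp_mul_left ((ε * c)⁻¹) v x
    rw [deriv_const_mul_field]
    simp only [div_eq_inv_mul, smul_eq_mul] at h ⊢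
    rw [h, mul_inv]
    ring
  obtain ⟨A, hA⟩ := (isCompact_Icc (a := (0:ℝ)) (b := T)).bddAbove_image
    (f := fun t => (z * deriv v t / c) ^ 2) (by fun_prop)
  have hA' : ∀ t ∈ Icc 0 T, (z * deriv v t / c) ^ 2 ≤ A := fun t ht =>
    hA (mem_image_of_mem _ ht)
  have hA0 : 0 ≤ A := (sq_nonneg _).trans (hA' 0 ⟨le_rfl, hT.le⟩)
  set I := ∫ t in (0:ℝ)..T, (iteratedDeriv k v t) ^ 2 with hI
  have hI0 : 0 ≤ I := intervalIntegral.integral_nonneg hT.le fun _ _ => sq_nonneg _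
  have hlog : Tendsto (fun ε : ℝ => -log ε) (𝓝[>] 0) atTop :=
    tendsto_neg_atBot_atTop.comp tendsto_log_nhdsGT_zero
  have hg : Tendsto (fun ε : ℝ =>
      c * T * (1 + (log (1 + A) + log (-log ε)) / (-log ε)) + c * I) (𝓝[>] 0)
      (𝓝 (c * (T + I))) := by
    have h := ((((tendsto_const_add_log_div_atTop (log (1 + A))).comp hlog).const_add 1).const_mul
      (c * T)).add_const (c * I)
    simpa only [Function.comp_def, add_zero, mul_one, mul_add] using h
  have hsmall : ∀ᶠ ε : ℝ in 𝓝[>] 0, 0 < ε ∧ ε ≤ 1 ∧ 1 ≤ -log ε := by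
    filter_upwards [Ioc_mem_nhdsGT (zero_lt_one' ℝ), hlog.eventually_ge_atTop 1] with ε h1 h2
    exact ⟨h1.1, h1.2, h2⟩
  rw [← hg.limsup_eq]
  refine limsup_le_limsup ?_ ?_ hg.isBoundedUnder_le
  · filter_upwards [hsmall] with ε ⟨hε, hε1, hl⟩
    rw [rescaled_iteratedDeriv_energy hk T hv' hc hcz hε]
    gcongr
    have hl0 : 0 < -log ε := by linarith
    refine (le_norm_self _).trans ((intervalIntegral.norm_integral_le_of_norm_le_const
      (C := 1 / (ε * -log ε) * (log (1 + A) + log (-log ε) - log ε)) fun x hx => ?_).trans_eq ?_)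
    · rw [uIoc_of_le (by positivity)] at hx
      have hx' : x / (ε * c) ∈ Icc 0 T := by
        refine ⟨div_nonneg hx.1.le (by positivity), ?_⟩
        rw [div_le_iff₀ (by positivity)]
        exact hx.2.trans_eq (by ring)
      have hnn : 0 ≤ log (1 + ε * -log ε * deriv (fun y : ℝ => z * v (y / (ε * c))) x ^ 2) :=
        log_nonneg (le_add_of_nonneg_right (by positivity))
      rw [norm_of_nonneg (by positivity), hderiv]
      gcongr
      exact log_one_add_mul_div_sq_le hε hε1 hl hA0 (hA' _ hx')
    · rw [sub_zero, abs_of_pos (by positivity)]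
      generalize log (1 + A) + log (-log ε) = B
      have : log ε ≠ 0 := by linarith
      field_simp
      ring
  · refine IsBoundedUnder.isCoboundedUnder_le (isBoundedUnder_of_eventually_ge (a := 0) ?_)
    filter_upwards [hsmall] with ε ⟨hε, hε1, hl⟩
    rw [rescaled_iteratedDeriv_energy hk T hv' hc hcz hε]
    have hl0 : 0 < -log ε := by linarith
    refine add_nonneg (intervalIntegral.integral_nonneg (by positivity) fun x _ => ?_)
      (by positivity)
    exact mul_nonneg (by positivity) (log_nonneg (le_add_of_nonneg_right (by positivity)))
end

section
/- Let p : (0,1) → (0,∞) be an admissible exponent family. For every η > 0 there exists ε₀ ∈ (0,1) such that for all ε ∈ (0,ε₀) and all z ∈ ℝ one has (1/(2·ε·|log ε|))·log(1 + z²) ≥ (1−η)·min{ε^{1−2p(ε)}·z², 1/ε}. -/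
open Real Filter Topology Set

/-- Concavity of `t ↦ log (1 + t)`, in the form of Bernoulli's inequality. -/
theorem min_mul_log_one_add_le_log_one_add {a w : ℝ} (ha : 0 < a) (hw : 0 ≤ w) :
    min (a⁻¹ * w) 1 * Real.log (1 + a) ≤ Real.log (1 + w) := by
  set m := min (a⁻¹ * w) 1
  have hm0 : 0 ≤ m := le_min (by positivity) zero_le_one
  have hma : m * a ≤ w := by
    calc m * a ≤ a⁻¹ * w * a := by gcongr; exact min_le_left _ _
      _ = w := by field_simp
  rw [← Real.log_rpow (by positivity)]
  refine Real.log_le_log (by positivity) ?_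
  have := rpow_one_add_le_one_add_mul_self (s := a) (by linarith) hm0 (min_le_right _ _)
  linarith

theorem one_sub_mul_truncated_quadratic_le {ε q : ℝ} (h0 : 0 < ε) (h1 : ε < 1) (z : ℝ) :
    (1 - q) * min (ε ^ (1 - 2 * q) * z ^ 2) (1 / ε) ≤
      (1 / (2 * ε * (-Real.log ε))) * Real.log (1 + z ^ 2) := by
  have hL : 0 < -Real.log ε := neg_pos.2 (Real.log_neg h0 h1)
  set a := ε ^ (2 * q - 2) with ha_def
  have ha : 0 < a := Real.rpow_pos_of_pos h0 _
  have hpow : ε ^ (1 - 2 * q) = 1 / ε * a⁻¹ := by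
    rw [ha_def, ← Real.rpow_neg h0.le, one_div, ← Real.rpow_neg_one ε, ← Real.rpow_add h0]
    ring_nf
  have hmin : min (ε ^ (1 - 2 * q) * z ^ 2) (1 / ε) = 1 / ε * min (a⁻¹ * z ^ 2) 1 := by
    rw [hpow, mul_min_of_nonneg _ _ (by positivity), mul_one, mul_assoc]
  have hm0 : 0 ≤ min (a⁻¹ * z ^ 2) 1 := le_min (by positivity) zero_le_one
  have hlog : 2 * (1 - q) * (-Real.log ε) ≤ Real.log (1 + a) := by
    calc 2 * (1 - q) * (-Real.log ε) = Real.log a := by rw [ha_def, Real.log_rpow h0]; ring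
      _ ≤ Real.log (1 + a) := Real.log_le_log ha (by linarith)
  have key := (mul_le_mul_of_nonneg_left hlog hm0).trans
    (min_mul_log_one_add_le_log_one_add ha (sq_nonneg z))
  rw [hmin]
  calc (1 - q) * (1 / ε * min (a⁻¹ * z ^ 2) 1)
      = 1 / (2 * ε * (-Real.log ε)) *
          (min (a⁻¹ * z ^ 2) 1 * (2 * (1 - q) * (-Real.log ε))) := by
        generalize -Real.log ε = L at hL
        field_simp
    _ ≤ _ := by gcongr

theorem stmt_18 (p : ℝ → ℝ) (hp : IsAdmissibleExponent p) :
    ∀ η : ℝ, 0 < η → ∃ ε₀ ∈ Set.Ioo (0:ℝ) 1, ∀ ε ∈ Set.Ioo (0:ℝ) ε₀, ∀ z : ℝ,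
      (1 - η) * min (ε ^ (1 - 2 * p ε) * z ^ 2) (1 / ε) ≤
        (1 / (2 * ε * (-Real.log ε))) * Real.log (1 + z ^ 2) := by
  intro η hη
  obtain ⟨δ, hδ, hsub⟩ := mem_nhdsGT_iff_exists_Ioo_subset.1 (hp.2.1.eventually_lt_const hη)
  have hδ0 : 0 < δ := hδ
  refine ⟨min δ (1 / 2), ⟨by positivity, by linarith [min_le_right δ (1 / 2)]⟩, ?_⟩
  rintro ε ⟨h0, h⟩ z
  have hpε : p ε < η := hsub ⟨h0, h.trans_le (min_le_left _ _)⟩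
  have h1 : ε < 1 := by linarith [min_le_right δ (1 / 2)]
  refine le_trans ?_ (one_sub_mul_truncated_quadratic_le (q := p ε) h0 h1 z)
  gcongr
end

section
/- Let k ≥ 1 be an integer, T̄ > 0, v̄ : ℝ → ℝ of class C^k, and z ∈ ℝ with z ≠ 0. For ε ∈ (0,1) set L_ε := |z|^{1/k}·T̄·ε and u_ε(x) := z·v̄(x/(ε·|z|^{1/k})) for x ∈ ℝ. Then limsup_{ε → 0⁺} [ ∫_0^{L_ε} (1/(2·ε·|log ε|))·log(1 + u_ε'(x)²) dx + ε^{2k−1}·∫_0^{L_ε} |u_ε^{(k)}(x)|² dx ] ≤ |z|^{1/k}·( T̄ + ∫_0^{T̄} |v̄^{(k)}(t)|² dt ). -/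
open Real Filter Topology Set MeasureTheory intervalIntegral

/-- The iterated derivatives of a rescaled profile. -/
theorem iteratedDeriv_rescaled {n : ℕ} {v : ℝ → ℝ} (hv : ContDiff ℝ n v) (z c x : ℝ) :
    iteratedDeriv n (fun y : ℝ => z * v (y / c)) x =
      z * (c⁻¹ ^ n * iteratedDeriv n v (x / c)) := by
  have h := congrFun (iteratedDeriv_comp_const_mul hv c⁻¹) x
  rw [iteratedDeriv_const_mul_field]
  simpa only [div_eq_inv_mul] using congrArg (z * ·) h

/-- Rescaling turns the highest order energy into that of the unscaled profile. -/
theorem integral_sq_iteratedDeriv_rescaled {k : ℕ} (hk : 1 ≤ k) {v : ℝ → ℝ}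
    (hv : ContDiff ℝ k v) {z a ε : ℝ} (T : ℝ) (ha : 0 < a) (hak : a ^ k = |z|) (hε : 0 < ε) :
    ε ^ (2 * k - 1) * ∫ x in (0:ℝ)..(a * T * ε),
        (iteratedDeriv k (fun y : ℝ => z * v (y / (ε * a))) x) ^ 2 =
      a * ∫ t in (0:ℝ)..T, (iteratedDeriv k v t) ^ 2 := by
  have hc : ε * a ≠ 0 := by positivity
  have hz2 : z ^ 2 = (a ^ k) ^ 2 := by rw [hak, sq_abs]
  have h1 : ∀ x, (iteratedDeriv k (fun y : ℝ => z * v (y / (ε * a))) x) ^ 2 =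
      (z * (ε * a)⁻¹ ^ k) ^ 2 * (iteratedDeriv k v (x / (ε * a))) ^ 2 := by
    intro x
    rw [iteratedDeriv_rescaled hv]
    ring
  simp_rw [h1]
  rw [intervalIntegral.integral_const_mul,
    intervalIntegral.integral_comp_div (fun t => (iteratedDeriv k v t) ^ 2) hc, zero_div,
    show a * T * ε / (ε * a) = T by field_simp, smul_eq_mul, mul_pow, hz2]
  have hε' : ε ^ (2 * k - 1) * ε = (ε ^ k) ^ 2 := by
    rw [← pow_succ, ← pow_mul]
    congr 1
    omega
  have : ε ^ (2 * k - 1) * (ε * a) * ((a ^ k) ^ 2 * ((ε * a)⁻¹ ^ k) ^ 2) = a := by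
    rw [← mul_assoc (ε ^ (2 * k - 1)), hε', inv_pow, mul_pow]
    field_simp
  linear_combination (∫ t in (0:ℝ)..T, (iteratedDeriv k v t) ^ 2) * this

/-- The logarithmic energy density of a rescaled profile with slope at most `M`. -/
theorem log_one_add_sq_le {z a ε w M : ℝ} (hε : 0 < ε) (hε1 : ε < 1) (hw : |w| ≤ M) :
    Real.log (1 + (z * ((ε * a)⁻¹ * w)) ^ 2) ≤
      Real.log (1 + (z * a⁻¹ * M) ^ 2) + 2 * (-Real.log ε) := by
  have hrhs : Real.log (1 + (z * a⁻¹ * M) ^ 2) + 2 * (-Real.log ε) =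
      Real.log ((1 + (z * a⁻¹ * M) ^ 2) / ε ^ 2) := by
    rw [Real.log_div (by positivity) (by positivity), Real.log_pow]
    push_cast
    ring
  rw [hrhs]
  apply Real.log_le_log (by positivity)
  rw [le_div_iff₀ (by positivity)]
  have h1 : (1 + (z * ((ε * a)⁻¹ * w)) ^ 2) * ε ^ 2 = ε ^ 2 + (z * a⁻¹) ^ 2 * w ^ 2 := by
    rw [mul_inv]
    field_simp
  have h2 : w ^ 2 ≤ M ^ 2 := by
    rw [← sq_abs w]
    gcongr
  have h3 : ε ^ 2 ≤ 1 := pow_le_one₀ hε.le hε1.le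
  rw [h1, mul_pow (z * a⁻¹)]
  gcongr

/-- The logarithmic energy of a rescaled profile with slope at most `M` on `[0, T]`. -/
theorem integral_log_rescaled_le {v : ℝ → ℝ} (hv : ContDiff ℝ 1 v) {z a ε T M : ℝ}
    (hT : 0 < T) (ha : 0 < a) (hε : 0 < ε) (hε1 : ε < 1)
    (hM : ∀ t ∈ Icc 0 T, |deriv v t| ≤ M) :
    (∫ x in (0:ℝ)..(a * T * ε), (1 / (2 * ε * (-Real.log ε))) * Real.log (1 +
        (deriv (fun y : ℝ => z * v (y / (ε * a))) x) ^ 2)) ≤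
      a * T * (1 + Real.log (1 + (z * a⁻¹ * M) ^ 2) / 2 * (-Real.log ε)⁻¹) := by
  have hL : 0 < -Real.log ε := neg_pos.2 (Real.log_neg hε hε1)
  have hb : ∀ x ∈ uIoc 0 (a * T * ε), ‖(1 / (2 * ε * (-Real.log ε))) * Real.log (1 +
        (deriv (fun y : ℝ => z * v (y / (ε * a))) x) ^ 2)‖ ≤
      (1 / (2 * ε * (-Real.log ε))) *
        (Real.log (1 + (z * a⁻¹ * M) ^ 2) + 2 * (-Real.log ε)) := by
    intro x hx
    rw [uIoc_of_le (by positivity)] at hx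
    have hd : deriv (fun y : ℝ => z * v (y / (ε * a))) x =
        z * ((ε * a)⁻¹ * deriv v (x / (ε * a))) := by
      simpa using iteratedDeriv_rescaled (n := 1) (by exact_mod_cast hv) z (ε * a) x
    have hx' : x / (ε * a) ∈ Icc 0 T := by
      refine ⟨div_nonneg hx.1.le (by positivity), ?_⟩
      rw [div_le_iff₀ (by positivity)]
      linarith [hx.2]
    have hnn : 0 ≤ Real.log (1 + (deriv (fun y : ℝ => z * v (y / (ε * a))) x) ^ 2) :=
      Real.log_nonneg (by nlinarith [sq_nonneg (deriv (fun y : ℝ => z * v (y / (ε * a))) x)])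
    rw [Real.norm_of_nonneg (by positivity), hd]
    gcongr
    exact log_one_add_sq_le hε hε1 (hM _ hx')
  refine (le_norm_self _).trans ((norm_integral_le_of_norm_le_const hb).trans_eq ?_)
  rw [sub_zero, abs_of_pos (by positivity)]
  generalize -Real.log ε = L at hL
  field_simp
  ring

theorem stmt_19 (k : ℕ) (hk : 1 ≤ k) (T : ℝ) (hT : 0 < T)
    (v : ℝ → ℝ) (hv : ContDiff ℝ (k : ℕ∞) v) (z : ℝ) (hz : z ≠ 0) :
    Filter.limsup (fun ε : ℝ =>
        (∫ x in (0:ℝ)..(|z| ^ ((1:ℝ)/(k:ℝ)) * T * ε),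
          (1 / (2 * ε * (-Real.log ε))) * Real.log (1 +
            (deriv (fun y : ℝ => z * v (y / (ε * |z| ^ ((1:ℝ)/(k:ℝ))))) x) ^ 2)) +
        ε ^ (2 * k - 1) * ∫ x in (0:ℝ)..(|z| ^ ((1:ℝ)/(k:ℝ)) * T * ε),
          (iteratedDeriv k (fun y : ℝ => z * v (y / (ε * |z| ^ ((1:ℝ)/(k:ℝ))))) x) ^ 2)
      (𝓝[>] (0:ℝ)) ≤
    |z| ^ ((1:ℝ)/(k:ℝ)) * (T + ∫ t in (0:ℝ)..T, (iteratedDeriv k v t) ^ 2) := by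
  have hz' : 0 < |z| := abs_pos.2 hz
  have ha : 0 < |z| ^ ((1:ℝ)/(k:ℝ)) := by positivity
  have hak : (|z| ^ ((1:ℝ)/(k:ℝ))) ^ k = |z| := by
    rw [one_div, Real.rpow_inv_natCast_pow hz'.le (by omega)]
  generalize |z| ^ ((1:ℝ)/(k:ℝ)) = a at ha hak ⊢
  have hvk : ContDiff ℝ k v := by exact_mod_cast hv
  have hv1 : ContDiff ℝ 1 v := hvk.of_le (by exact_mod_cast hk)
  obtain ⟨M, hM⟩ := isCompact_Icc.exists_bound_of_continuousOn (s := Icc 0 T)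
    (hv1.continuous_deriv le_rfl).continuousOn
  set J := ∫ t in (0:ℝ)..T, (iteratedDeriv k v t) ^ 2
  set K := Real.log (1 + (z * a⁻¹ * M) ^ 2)
  have hlim : Tendsto (fun ε : ℝ => a * T * (1 + K / 2 * (-Real.log ε)⁻¹) + a * J)
      (𝓝[>] 0) (𝓝 (a * (T + J))) := by
    have h0 : Tendsto (fun ε : ℝ => (-Real.log ε)⁻¹) (𝓝[>] 0) (𝓝 0) :=
      tendsto_inv_atTop_zero.comp (tendsto_neg_atBot_atTop.comp Real.tendsto_log_nhdsGT_zero)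
    have h1 := (((h0.const_mul (K / 2)).const_add 1).const_mul (a * T)).add_const (a * J)
    convert h1 using 2
    ring
  have hmem : ∀ᶠ ε : ℝ in 𝓝[>] 0, ε ∈ Ioo (0:ℝ) 1 := Ioo_mem_nhdsGT one_pos
  rw [← hlim.limsup_eq]
  refine limsup_le_limsup ?_ ?_ hlim.isBoundedUnder_le
  · filter_upwards [hmem] with ε hε
    exact add_le_add (integral_log_rescaled_le hv1 hT ha hε.1 hε.2 hM)
      (integral_sq_iteratedDeriv_rescaled hk hvk T ha hak hε.1).le
  · refine IsBoundedUnder.isCoboundedUnder_le ⟨0, ?_⟩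
    rw [eventually_map]
    filter_upwards [hmem] with ε hε
    have hε0 : 0 < ε := hε.1
    have hL : 0 < -Real.log ε := neg_pos.2 (Real.log_neg hε.1 hε.2)
    have hle : 0 ≤ a * T * ε := by positivity
    refine add_nonneg (intervalIntegral.integral_nonneg hle fun x _ => ?_)
      (mul_nonneg (by positivity) (intervalIntegral.integral_nonneg hle fun x _ => sq_nonneg _))
    exact mul_nonneg (by positivity) (Real.log_nonneg (le_add_of_nonneg_right (sq_nonneg _)))
end
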